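/- arXiv:1209.0066 — 7 statements merged into one kernel-verified Lean document; each statement's English description precedes it below -/
import Mathlib

section
/- Define g(r) = [(K(r) − E(r))(E(r) − r'² K(r)) + E(r)((K(r) − E(r)) − (E(r) − r'² K(r)))] / (E(r) − r'² K(r))² for r ∈ (0,1). Then g is strictly increasing on (0,1), with limit 3/2 as r → 0⁺ and limit +∞ as r → 1⁻ (so it maps (0,1) onto (3/2, ∞)). -/
open Real Set Filter Topology

/-- The complete elliptic integral of the second kind. -/
noncomputable def ellipticE (r : ℝ) : ℝ :=
  ∫ θ in (0:ℝ)..(π/2), Real.sqrt (1 - r^2 * Real.sin θ ^ 2)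

/-- The complete elliptic integral of the first kind. -/
noncomputable def ellipticK (r : ℝ) : ℝ :=
  ∫ θ in (0:ℝ)..(π/2), (1 - r^2 * Real.sin θ ^ 2) ^ (-(1:ℝ)/2)

noncomputable def MM (p : ℝ) (w : ℝ → ℝ) (m : ℝ) : ℝ :=
  ∫ θ in (0:ℝ)..(π/2), w θ * (1 - m * Real.sin θ ^ 2) ^ p

lemma base_pos {m : ℝ} (hm : m < 1) (θ : ℝ) : 0 < 1 - m * Real.sin θ ^ 2 := by
  have h1 := Real.sin_sq_le_one θ
  have h0 := sq_nonneg (Real.sin θ)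
  rcases le_or_gt m 0 with h | h <;> nlinarith

lemma MM_cont (p : ℝ) {w : ℝ → ℝ} (hw : Continuous w) {m : ℝ} (hm : m < 1) :
    Continuous (fun θ => w θ * (1 - m * Real.sin θ ^ 2) ^ p) := by
  refine hw.mul (Continuous.rpow_const (by fun_prop) fun θ => Or.inl (base_pos hm θ).ne')

lemma MM_int (p : ℝ) {w : ℝ → ℝ} (hw : Continuous w) {m : ℝ} (hm : m < 1) (a b : ℝ) :
    IntervalIntegrable (fun θ => w θ * (1 - m * Real.sin θ ^ 2) ^ p) MeasureTheory.volume a b :=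
  (MM_cont p hw hm).intervalIntegrable a b

lemma MM_deriv (p : ℝ) {w : ℝ → ℝ} (hw : Continuous w) {m : ℝ} (hm : m < 1) :
    HasDerivAt (MM p w) (MM (p - 1) (fun θ => -p * Real.sin θ ^ 2 * w θ) m) m := by
  set d := (1 - m) / 2 with hd
  have hd0 : 0 < d := by rw [hd]; linarith
  have hlt : ∀ x ∈ Metric.closedBall m d, x < 1 := by
    intro x hx
    rw [Metric.mem_closedBall, Real.dist_eq, abs_le] at hx
    linarith [hx.2]
  have hcont : ContinuousOn (fun z : ℝ × ℝ => (-p * Real.sin z.2 ^ 2 * w z.2) *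
      (1 - z.1 * Real.sin z.2 ^ 2) ^ (p - 1)) (Metric.closedBall m d ×ˢ Icc 0 (π/2)) := by
    refine ContinuousOn.mul (by fun_prop) (ContinuousOn.rpow_const (by fun_prop) ?_)
    intro z hz
    exact Or.inl (base_pos (hlt _ hz.1) _).ne'
  obtain ⟨B, hB⟩ := ((isCompact_closedBall m d).prod isCompact_Icc).exists_bound_of_continuousOn hcont
  have hpi : (0:ℝ) ≤ π / 2 := by positivity
  have hw' : Continuous (fun θ => -p * Real.sin θ ^ 2 * w θ) := by fun_prop
  refine (intervalIntegral.hasDerivAt_integral_of_dominated_loc_of_deriv_le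
    (F := fun x θ => w θ * (1 - x * Real.sin θ ^ 2) ^ p)
    (F' := fun x θ => (-p * Real.sin θ ^ 2 * w θ) * (1 - x * Real.sin θ ^ 2) ^ (p - 1))
    (bound := fun _ => B)
    (Metric.closedBall_mem_nhds m hd0) ?_ (MM_int p hw hm _ _)
    (MM_cont _ hw' hm).aestronglyMeasurable ?_ (by simp) ?_).2
  · filter_upwards [Metric.closedBall_mem_nhds m hd0] with x hx
    exact (MM_cont p hw (hlt x hx)).aestronglyMeasurable
  · refine Filter.Eventually.of_forall fun θ hθ x hx => ?_
    rw [uIoc_of_le hpi] at hθ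
    exact hB (x, θ) ⟨hx, hθ.1.le, hθ.2⟩
  · refine Filter.Eventually.of_forall fun θ hθ x hx => ?_
    have h1 : HasDerivAt (fun x : ℝ => 1 - x * Real.sin θ ^ 2) (-(Real.sin θ ^ 2)) x := by
      simpa using ((hasDerivAt_id x).mul_const (Real.sin θ ^ 2)).const_sub 1
    have h2 := (h1.rpow_const (p := p) (Or.inl (base_pos (hlt x hx) θ).ne')).const_mul (w θ)
    refine h2.congr_deriv ?_
    ring

/-- first kind, in m -/
noncomputable def Kf : ℝ → ℝ := MM (-1/2) (fun _ => 1)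
/-- second kind, in m -/
noncomputable def Ef : ℝ → ℝ := MM (1/2) (fun _ => 1)
noncomputable def Sf : ℝ → ℝ := MM (-1/2) (fun θ => Real.sin θ ^ 2)
noncomputable def Cf : ℝ → ℝ := MM (-1/2) (fun θ => Real.cos θ ^ 2)
noncomputable def Nf : ℝ → ℝ := MM (-1/2) (fun θ => Real.sin θ ^ 2 - Real.cos θ ^ 2)

lemma ellipticK_eq (r : ℝ) : ellipticK r = Kf (r^2) := by
  simp [ellipticK, Kf, MM]

lemma ellipticE_eq (r : ℝ) : ellipticE r = Ef (r^2) := by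
  simp [ellipticE, Ef, MM, Real.sqrt_eq_rpow]

lemma Kf_eq {m : ℝ} (hm : m < 1) : Kf m = Sf m + Cf m := by
  unfold Kf Sf Cf MM
  rw [← intervalIntegral.integral_add (MM_int _ (by fun_prop) hm _ _) (MM_int _ (by fun_prop) hm _ _)]
  congr 1; ext θ
  rw [← add_mul, Real.sin_sq_add_cos_sq]

lemma Nf_eq {m : ℝ} (hm : m < 1) : Nf m = Sf m - Cf m := by
  unfold Nf Sf Cf MM
  rw [← intervalIntegral.integral_sub (MM_int _ (by fun_prop) hm _ _) (MM_int _ (by fun_prop) hm _ _)]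
  congr 1; ext θ
  ring

lemma Ef_eq {m : ℝ} (hm : m < 1) : Ef m = Cf m + (1 - m) * Sf m := by
  unfold Ef Sf Cf MM
  rw [← intervalIntegral.integral_const_mul, ← intervalIntegral.integral_add
    (MM_int _ (by fun_prop) hm _ _) ((MM_int _ (by fun_prop) hm _ _).const_mul _)]
  congr 1; ext θ
  have h := base_pos hm θ
  have h1 : (1 - m * Real.sin θ ^ 2) ^ (1/2:ℝ) =
      (1 - m * Real.sin θ ^ 2) * (1 - m * Real.sin θ ^ 2) ^ (-1/2:ℝ) := by
    rw [← Real.rpow_one_add' h.le (by norm_num)]; norm_num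
  rw [h1, Real.cos_sq']; ring

lemma Sf_pos {m : ℝ} (hm : m < 1) : 0 < Sf m := by
  apply intervalIntegral.intervalIntegral_pos_of_pos_on (MM_int _ (by fun_prop) hm _ _)
  · intro x hx
    have := Real.sin_pos_of_pos_of_lt_pi hx.1 (by linarith [hx.2, Real.pi_pos])
    have := base_pos hm x
    positivity
  · positivity

lemma Cf_pos {m : ℝ} (hm : m < 1) : 0 < Cf m := by
  apply intervalIntegral.intervalIntegral_pos_of_pos_on (MM_int _ (by fun_prop) hm _ _)
  · intro x hx
    have := Real.cos_pos_of_mem_Ioo ⟨by linarith [hx.1, Real.pi_pos], hx.2⟩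
    have := base_pos hm x
    positivity
  · positivity

lemma rpow_aux {x : ℝ} (h : 0 < x) : x ^ (1/2:ℝ) = x ^ 2 * x ^ (-3/2:ℝ) := by
  rw [← Real.rpow_natCast x 2, ← Real.rpow_add h]; norm_num

lemma I3 {m : ℝ} (hm : m < 1) : (1 - m) * MM (-3/2) (fun _ => 1) m = Ef m := by
  have key : ∀ θ ∈ uIcc (0:ℝ) (π/2), HasDerivAt
      (fun θ => m * (Real.sin θ * Real.cos θ) * (1 - m * Real.sin θ ^ 2) ^ (-1/2:ℝ))
      (1 * (1 - m * Real.sin θ ^ 2) ^ (1/2:ℝ) - (1 - m) * (1 * (1 - m * Real.sin θ ^ 2) ^ (-3/2:ℝ))) θ := by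
    intro θ _
    have h := base_pos hm θ
    have h1 : HasDerivAt (fun θ => 1 - m * Real.sin θ ^ 2) (-(m * (2 * Real.sin θ * Real.cos θ))) θ := by
      have := (((Real.hasDerivAt_sin θ).pow 2).const_mul m).const_sub 1
      exact this.congr_deriv (by simp)
    have h2 := h1.rpow_const (p := (-1/2:ℝ)) (Or.inl h.ne')
    have h3 := (((Real.hasDerivAt_sin θ).mul (Real.hasDerivAt_cos θ)).const_mul m).mul h2
    refine h3.congr_deriv (Eq.symm ?_)
    have e1 : (1 - m * Real.sin θ ^ 2) ^ (1/2:ℝ) =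
      (1 - m * Real.sin θ ^ 2)^2 * (1 - m * Real.sin θ ^ 2) ^ (-3/2:ℝ) := by
      exact rpow_aux h
    have e2 : (1 - m * Real.sin θ ^ 2) ^ (-1/2:ℝ) =
      (1 - m * Real.sin θ ^ 2) * (1 - m * Real.sin θ ^ 2) ^ (-3/2:ℝ) := by
      rw [← Real.rpow_one_add' h.le (by norm_num)]; norm_num
    have e3 : (-1/2 - 1 : ℝ) = -3/2 := by norm_num
    rw [Pi.mul_apply, e3, e1, e2]
    have hc := Real.cos_sq' θ
    set s := Real.sin θ
    set c := Real.cos θ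
    set R := (1 - m * s ^ 2) ^ (-3/2:ℝ)
    linear_combination (m * (1 - m * s^2) * R - m ^2 * s^2 * R + 2 * m^2*s^2*R) * (-hc)
  have hi1 := MM_int (1/2) (w := fun _ => 1) (by fun_prop) hm 0 (π/2)
  have hi2 := (MM_int (-3/2) (w := fun _ => 1) (by fun_prop) hm 0 (π/2)).const_mul (1-m)
  have := intervalIntegral.integral_eq_sub_of_hasDerivAt key (hi1.sub hi2)
  rw [intervalIntegral.integral_sub hi1 hi2,
    intervalIntegral.integral_const_mul (1 - m) (fun θ => 1 * (1 - m * Real.sin θ ^ 2) ^ (-3/2:ℝ))] at this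
  simp only [Real.sin_zero, Real.cos_pi_div_two, mul_zero, zero_mul, sub_zero] at this
  unfold Ef MM
  linarith

lemma Kf_deriv {m : ℝ} (h0 : m ≠ 0) (hm : m < 1) :
    HasDerivAt Kf ((Ef m / (1 - m) - Kf m) / (2 * m)) m := by
  have h := MM_deriv (-1/2) (w := fun _ => (1:ℝ)) (by fun_prop) hm
  refine h.congr_deriv (Eq.symm ?_)
  rw [← I3 hm]
  have hq : 1 - m ≠ 0 := by linarith
  rw [mul_div_cancel_left₀ _ hq, div_eq_iff (by positivity)]
  unfold Kf MM
  rw [← intervalIntegral.integral_sub (MM_int _ (by fun_prop) hm _ _) (MM_int _ (by fun_prop) hm _ _),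
    ← intervalIntegral.integral_mul_const]
  congr 1; ext θ
  have h := base_pos hm θ
  have e2 : (1 - m * Real.sin θ ^ 2) ^ (-1/2:ℝ) =
      (1 - m * Real.sin θ ^ 2) * (1 - m * Real.sin θ ^ 2) ^ (-3/2:ℝ) := by
    rw [← Real.rpow_one_add' h.le (by norm_num)]; norm_num
  have e3 : (-1/2 - 1 : ℝ) = -3/2 := by norm_num
  rw [e3, e2]; ring

lemma Ef_deriv {m : ℝ} (h0 : m ≠ 0) (hm : m < 1) :
    HasDerivAt Ef ((Ef m - Kf m) / (2 * m)) m := by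
  have h := MM_deriv (1/2) (w := fun _ => (1:ℝ)) (by fun_prop) hm
  refine h.congr_deriv (Eq.symm ?_)
  rw [div_eq_iff (by positivity)]
  unfold Kf Ef MM
  rw [← intervalIntegral.integral_sub (MM_int _ (by fun_prop) hm _ _) (MM_int _ (by fun_prop) hm _ _),
    ← intervalIntegral.integral_mul_const]
  congr 1; ext θ
  have h := base_pos hm θ
  have h1 : (1 - m * Real.sin θ ^ 2) ^ (1/2:ℝ) =
      (1 - m * Real.sin θ ^ 2) * (1 - m * Real.sin θ ^ 2) ^ (-1/2:ℝ) := by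
    rw [← Real.rpow_one_add' h.le (by norm_num)]; norm_num
  have e3 : (1/2 - 1 : ℝ) = -1/2 := by norm_num
  rw [e3, h1]; ring

lemma A_eq {m : ℝ} (hm : m < 1) : Kf m - Ef m = m * Sf m := by
  rw [Kf_eq hm, Ef_eq hm]; ring

lemma B_eq {m : ℝ} (hm : m < 1) : Ef m - (1 - m) * Kf m = m * Cf m := by
  rw [Kf_eq hm, Ef_eq hm]; ring

lemma A_deriv {m : ℝ} (h0 : 0 < m) (hm : m < 1) :
    HasDerivAt (fun m => Kf m - Ef m) (Ef m / (2 * (1 - m))) m := by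
  refine ((Kf_deriv h0.ne' hm).sub (Ef_deriv h0.ne' hm)).congr_deriv ?_
  have hq : 1 - m ≠ 0 := by linarith
  field_simp
  ring

lemma B_deriv {m : ℝ} (h0 : 0 < m) (hm : m < 1) :
    HasDerivAt (fun m => Ef m - (1 - m) * Kf m) (Kf m / 2) m := by
  have h1 : HasDerivAt (fun m : ℝ => 1 - m) (-1) m := by
    simpa using (hasDerivAt_id m).const_sub 1
  refine ((Ef_deriv h0.ne' hm).sub (h1.mul (Kf_deriv h0.ne' hm))).congr_deriv ?_
  have hq : 1 - m ≠ 0 := by linarith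
  field_simp
  ring

noncomputable def Df (m : ℝ) : ℝ := (Ef m - (1 - m) * Kf m) - (1 - m) ^ (1/4:ℝ) * (Kf m - Ef m)

lemma x_facts {m : ℝ} (h0 : 0 < m) (hm : m < 1) : 0 < (1 - m) ^ (1/4:ℝ) ∧ (1 - m) ^ (1/4:ℝ) < 1 ∧
    1 - m = ((1 - m) ^ (1/4:ℝ)) ^ 4 := by
  have hq : 0 < 1 - m := by linarith
  refine ⟨by positivity, Real.rpow_lt_one hq.le (by linarith) (by norm_num), ?_⟩
  rw [← Real.rpow_natCast, ← Real.rpow_mul hq.le]; norm_num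

lemma Df_deriv {m : ℝ} (h0 : 0 < m) (hm : m < 1) (hD : Df m ≤ 0) :
    ∃ d, 0 < d ∧ HasDerivAt Df d m := by
  have hq : 0 < 1 - m := by linarith
  have h1 : HasDerivAt (fun m : ℝ => 1 - m) (-1) m := by
    simpa using (hasDerivAt_id m).const_sub 1
  have h2 := h1.rpow_const (p := (1/4:ℝ)) (Or.inl hq.ne')
  refine ⟨_, ?_, (B_deriv h0 hm).sub (h2.mul (A_deriv h0 hm))⟩
  rw [A_eq hm]
  obtain ⟨hx0, hx1, hx⟩ := x_facts h0 hm
  have e : (1 - m) ^ ((1/4:ℝ) - 1) = (1 - m) ^ (1/4:ℝ) / (1 - m) := by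
    rw [Real.rpow_sub hq, Real.rpow_one]
  rw [e]
  unfold Df at hD
  rw [A_eq hm, B_eq hm] at hD
  rw [Kf_eq hm, Ef_eq hm]
  have hS := Sf_pos hm
  set x := (1 - m) ^ (1/4:ℝ)
  set S := Sf m
  set C := Cf m
  have hC : C ≤ x * S := by
    have : m * (C - x * S) ≤ 0 := by linarith
    nlinarith
  have hm' : m = 1 - x ^ 4 := by linarith
  clear_value x S C
  subst hm'
  have hx3 : x ^ 3 < 1 := pow_lt_one₀ hx0.le hx1 (by norm_num)
  have key : 0 < 2 * x^4 * (S + C) - 2 * x * (C + x^4 * S) + x * (1 - x^4) * S := by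
    have a1 : 0 ≤ 2 * x * (1 - x^3) * (x * S - C) :=
      mul_nonneg (mul_nonneg (by linarith) (by linarith)) (by linarith)
    have a2 : 0 < S * (x * (1-x)^3*(1+x)) := by
      have : 0 < 1 - x := by linarith
      positivity
    nlinarith
  have : 0 < (2 * x^4 * (S + C) - 2 * x * (C + x^4 * S) + x * (1 - x^4) * S) / (4 * x^4) := by positivity
  refine this.trans_eq ?_
  have : (1 - (1 - x^4)) = x^4 := by ring
  rw [this]
  field_simp
  ring

lemma Kf_cont {m : ℝ} (hm : m < 1) : ContinuousAt Kf m := (MM_deriv _ (by fun_prop) hm).continuousAt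
lemma Ef_cont {m : ℝ} (hm : m < 1) : ContinuousAt Ef m := (MM_deriv _ (by fun_prop) hm).continuousAt
lemma Sf_cont {m : ℝ} (hm : m < 1) : ContinuousAt Sf m := (MM_deriv _ (by fun_prop) hm).continuousAt
lemma Cf_cont {m : ℝ} (hm : m < 1) : ContinuousAt Cf m := (MM_deriv _ (by fun_prop) hm).continuousAt

lemma Df_cont {m : ℝ} (hm : m < 1) : ContinuousAt Df m := by
  unfold Df
  have h1 := Kf_cont hm
  have h2 := Ef_cont hm
  have h3 : ContinuousAt (fun m : ℝ => (1 - m) ^ (1/4:ℝ)) m :=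
    ContinuousAt.rpow_const (by fun_prop) (Or.inr (by norm_num))
  fun_prop

lemma Df_pos {m : ℝ} (h0 : 0 < m) (hm : m < 1) : 0 < Df m := by
  by_contra hcon
  push Not at hcon
  have hc : ContinuousOn Df (Icc 0 m) := fun y hy => (Df_cont (hy.2.trans_lt hm)).continuousWithinAt
  have hD0 : Df 0 = 0 := by
    unfold Df; rw [B_eq one_pos, A_eq one_pos]; simp
  have hp : ∃ p, 0 < p ∧ p ≤ m ∧ Df p ≤ 0 ∧ ∀ y ∈ Icc 0 m, Df p ≤ Df y := by
    obtain ⟨p, hp, hmin⟩ := isCompact_Icc.exists_isMinOn ⟨m, h0.le, le_rfl⟩ hc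
    have hmin' : ∀ y ∈ Icc 0 m, Df p ≤ Df y := fun y hy => hmin hy
    rcases hp.1.eq_or_lt with h | h
    · subst h
      refine ⟨m, h0, le_rfl, hcon, fun y hy => ?_⟩
      linarith [hmin' y hy]
    · exact ⟨p, h, hp.2, (hmin' m ⟨h0.le, le_rfl⟩).trans hcon, hmin'⟩
  obtain ⟨p, hp0, hpm, hpD, hmin⟩ := hp
  obtain ⟨d, hd, hder⟩ := Df_deriv hp0 (hpm.trans_lt hm) hpD
  have ht := (hasDerivAt_iff_tendsto_slope.1 hder).mono_left
    (nhdsWithin_mono p (s := Iio p) (fun y hy => ne_of_lt hy))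
  have h1 := ht.eventually (lt_mem_nhds hd)
  have h2 : ∀ᶠ y in 𝓝[<] p, y ∈ Ioo 0 p := Ioo_mem_nhdsLT hp0
  obtain ⟨y, hy1, hy2⟩ := (h1.and h2).exists
  rw [slope_def_field] at hy1
  have := hmin y ⟨hy2.1.le, hy2.2.le.trans hpm⟩
  have : (Df y - Df p) / (y - p) ≤ 0 :=
    div_nonpos_of_nonneg_of_nonpos (by linarith) (by linarith [hy2.2])
  linarith

noncomputable def Gf (m : ℝ) : ℝ :=
  ((Kf m - Ef m) * (Ef m - (1 - m) * Kf m) +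
    Ef m * ((Kf m - Ef m) - (Ef m - (1 - m) * Kf m))) / (Ef m - (1 - m) * Kf m)^2

lemma Gf_deriv {m : ℝ} (h0 : 0 < m) (hm : m < 1) : ∃ d, 0 < d ∧ HasDerivAt Gf d m := by
  have hA := A_deriv h0 hm
  have hB := B_deriv h0 hm
  have hE := Ef_deriv h0.ne' hm
  have hS := Sf_pos hm
  have hC := Cf_pos hm
  have hBne : (Ef m - (1 - m) * Kf m)^2 ≠ 0 := by rw [B_eq hm]; positivity
  have hG := ((hA.mul hB).add (hE.mul (hA.sub hB))).div (hB.pow 2) hBne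
  refine ⟨_, ?_, hG⟩
  have hD := Df_pos h0 hm
  unfold Df at hD
  obtain ⟨hx0, hx1, hx⟩ := x_facts h0 hm
  simp only [Pi.mul_apply, Pi.add_apply, Pi.sub_apply, Pi.pow_apply]
  have hEK : Ef m - Kf m = - (m * Sf m) := by rw [← A_eq hm]; ring
  rw [hEK]
  rw [A_eq hm, B_eq hm] at *
  rw [Kf_eq hm, Ef_eq hm]
  set x := (1 - m) ^ (1/4:ℝ)
  set S := Sf m
  set C := Cf m
  have hd : 0 < C - x * S := by
    have : 0 < m * (C - x * S) := by linarith
    exact pos_of_mul_pos_right this h0.le |> fun h => h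
  obtain ⟨δ, hδ⟩ : ∃ δ, δ = C - x * S := ⟨_, rfl⟩
  rw [← hδ] at hd
  have hm' : m = 1 - x ^ 4 := by linarith
  have hCe : C = x * S + δ := by linarith
  have hPP : 0 < C^3 + x^4*S*C^2 - (2*x^4-x^8)*S^2*C - x^8*S^3 := by
    have hx2 : x^2 < 1 := pow_lt_one₀ hx0.le hx1 (by norm_num)
    have a1 : 0 < x^2*((3 - 2*x^2) + 2*x^3+x^6) := by
      have : 0 < 3 - 2 * x^2 := by linarith
      positivity
    have a2 : 0 < x^3*(1-x)^2*(x^4+x^3+x^2+2*x+1) := by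
      have : 0 < 1 - x := by linarith
      positivity
    have : 0 < δ^3 + δ^2*(3*x*S+x^4*S) + δ*S^2*(x^2*((3 - 2*x^2) + 2*x^3+x^6))
        + S^3 * (x^3*(1-x)^2*(x^4+x^3+x^2+2*x+1)) := by positivity
    refine this.trans_eq ?_
    rw [hCe]; ring
  have hq : 0 < 1 - m := by linarith
  have : 0 < (C^3 + x^4*S*C^2 - (2*x^4-x^8)*S^2*C - x^8*S^3) / ((1-m) * m^2*C^3) := by positivity
  refine this.trans_eq ?_
  have e8 : x^8 = (1-m)^2 := by rw [hx]; ring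
  rw [e8, ← hx]
  push_cast
  field_simp
  ring

lemma Gf_mono : StrictMonoOn Gf (Ioo 0 1) := by
  apply strictMonoOn_of_deriv_pos (convex_Ioo 0 1)
  · intro m hm
    obtain ⟨d, -, h⟩ := Gf_deriv hm.1 hm.2
    exact h.continuousAt.continuousWithinAt
  · intro m hm
    rw [interior_Ioo] at hm
    obtain ⟨d, hd, h⟩ := Gf_deriv hm.1 hm.2
    rwa [h.deriv]

lemma Gf_eq {m : ℝ} (h0 : 0 < m) (hm : m < 1) :
    Gf m = (m⁻¹ * Nf m) * (Sf m + Cf m) / (Cf m)^2 * (1 - m) + 2 * (Sf m / Cf m) - 1 := by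
  unfold Gf
  rw [A_eq hm, B_eq hm, Ef_eq hm, Nf_eq hm]
  have hC := Cf_pos hm
  field_simp
  ring

lemma Sf_zero : Sf 0 = π / 4 := by
  simp [Sf, MM, integral_sin_sq]; ring

lemma Cf_zero : Cf 0 = π / 4 := by
  simp [Cf, MM, integral_cos_sq]; ring

lemma Nf_deriv_zero : HasDerivAt Nf (π / 16) 0 := by
  have h := MM_deriv (-1/2) (w := fun θ => Real.sin θ ^ 2 - Real.cos θ ^ 2) (by fun_prop) one_pos
  refine h.congr_deriv ?_
  unfold MM
  have : ∀ θ : ℝ, -(-1/2) * Real.sin θ ^ 2 * (Real.sin θ ^ 2 - Real.cos θ ^ 2) *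
      (1 - 0 * Real.sin θ ^ 2) ^ (-1/2 - 1 : ℝ) =
      (1/2) * (Real.sin θ ^ 2 - 2 * (Real.sin θ ^ 2 * Real.cos θ ^ 2)) := by
    intro θ
    rw [zero_mul, sub_zero, Real.one_rpow]
    have := Real.cos_sq' θ
    linear_combination (-1/2 * Real.sin θ ^ 2 + Real.sin θ ^ 2) * this
  simp_rw [this]
  rw [intervalIntegral.integral_const_mul, intervalIntegral.integral_sub
    (Continuous.intervalIntegrable (by fun_prop) _ _) (Continuous.intervalIntegrable (by fun_prop) _ _),
    intervalIntegral.integral_const_mul, integral_sin_sq, integral_sin_sq_mul_cos_sq]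
  have : (4 * (π / 2)) = 2 * π := by ring
  rw [this]
  simp
  ring

lemma Gf_zero : Tendsto Gf (𝓝[>] 0) (𝓝 (3/2)) := by
  have hN : Tendsto (fun m => m⁻¹ * Nf m) (𝓝[>] 0) (𝓝 (π/16)) := by
    have hN0 : Nf 0 = 0 := by rw [Nf_eq one_pos, Sf_zero, Cf_zero]; ring
    have := (hasDerivAt_iff_tendsto_slope_zero.1 Nf_deriv_zero).mono_left
      (nhdsWithin_mono 0 (s := Ioi 0) (fun y hy => ne_of_gt hy))
    simpa [hN0] using this
  have hS : Tendsto Sf (𝓝[>] 0) (𝓝 (π/4)) := by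
    rw [← Sf_zero]; exact (Sf_cont one_pos).mono_left nhdsWithin_le_nhds
  have hC : Tendsto Cf (𝓝[>] 0) (𝓝 (π/4)) := by
    rw [← Cf_zero]; exact (Cf_cont one_pos).mono_left nhdsWithin_le_nhds
  have hm : Tendsto (fun m : ℝ => m) (𝓝[>] 0) (𝓝 0) := nhdsWithin_le_nhds
  have hpi : π / 4 ≠ 0 := by positivity
  have h := ((((hN.mul (hS.add hC)).div (hC.pow 2) (by positivity)).mul (hm.const_sub 1)).add
    ((hS.div hC hpi).const_mul 2)).sub_const 1
  have e : π / 16 * (π / 4 + π / 4) / (π / 4) ^ 2 * (1 - 0) + 2 * (π / 4 / (π / 4)) - 1 = 3/2 := by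
    field_simp; norm_num
  rw [e] at h
  refine h.congr' ?_
  have : ∀ᶠ y in 𝓝[>] (0:ℝ), y ∈ Ioo (0:ℝ) 1 := Ioo_mem_nhdsGT one_pos
  filter_upwards [this] with y hy
  exact (Gf_eq hy.1 hy.2).symm

lemma Cf_le {m : ℝ} (hm : m < 1) : Cf m ≤ 1 := by
  have : (1:ℝ) = ∫ θ in (0:ℝ)..(π/2), Real.cos θ := by simp
  rw [this]
  apply intervalIntegral.integral_mono_on_of_le_Ioo (by positivity) (MM_int _ (by fun_prop) hm _ _)
    (Real.continuous_cos.intervalIntegrable _ _)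
  intro θ hθ
  have hc := Real.cos_pos_of_mem_Ioo ⟨by linarith [hθ.1, Real.pi_pos], hθ.2⟩
  have h1 : Real.cos θ ^ 2 ≤ 1 - m * Real.sin θ ^ 2 := by
    rw [Real.cos_sq']; nlinarith [sq_nonneg (Real.sin θ)]
  have h2 := Real.rpow_le_rpow_of_nonpos (z := (-1/2:ℝ)) (by positivity) h1 (by norm_num)
  have h3 : (Real.cos θ ^ 2) ^ (-1/2:ℝ) = (Real.cos θ)⁻¹ := by
    rw [← Real.rpow_natCast, ← Real.rpow_mul hc.le]; norm_num [Real.rpow_neg_one]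
  rw [h3] at h2
  calc _ ≤ Real.cos θ ^ 2 * (Real.cos θ)⁻¹ := by gcongr
    _ = Real.cos θ := by field_simp

lemma Kf_ge {m : ℝ} (h0 : 0 < m) (hm : m < 1) : -(1/2) * Real.log (1 - m) ≤ Kf m := by
  have hq : 0 < 1 - m := by linarith
  obtain ⟨ε, hε⟩ : ∃ ε, ε = √(1 - m) := ⟨_, rfl⟩
  have hε0 : 0 < ε := by rw [hε]; positivity
  have hε2 : ε ^ 2 = 1 - m := by rw [hε, Real.sq_sqrt hq.le]
  have hy : ∀ θ ∈ Icc 0 (π/2), 0 < π/2 + ε - θ := fun θ hθ => by linarith [hθ.2]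
  have hpi : (0:ℝ) ≤ π / 2 := by positivity
  have hcont : ContinuousOn (fun θ => (π/2 + ε - θ)⁻¹) (uIcc 0 (π/2)) := by
    rw [uIcc_of_le hpi]
    exact ContinuousOn.inv₀ (by fun_prop) fun θ hθ => (hy θ hθ).ne'
  have hI : ∫ θ in (0:ℝ)..(π/2), (π/2 + ε - θ)⁻¹ = -Real.log ε + Real.log (π/2+ε) := by
    rw [intervalIntegral.integral_eq_sub_of_hasDerivAt
      (f := fun θ => -Real.log (π/2 + ε - θ)) _ hcont.intervalIntegrable]
    · simp
    · intro θ hθ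
      rw [uIcc_of_le hpi] at hθ
      have h1 : HasDerivAt (fun θ : ℝ => π/2 + ε - θ) (-1) θ := by
        simpa using (hasDerivAt_id θ).const_sub (π/2+ε)
      refine (h1.log (hy θ hθ).ne').neg.congr_deriv ?_
      rw [neg_div, neg_neg, one_div]
  have hle : ∫ θ in (0:ℝ)..(π/2), (π/2 + ε - θ)⁻¹ ≤ Kf m := by
    apply intervalIntegral.integral_mono_on hpi hcont.intervalIntegrable
      (MM_int _ (by fun_prop) hm _ _)
    intro θ hθ
    have hc0 : 0 ≤ Real.cos θ := Real.cos_nonneg_of_mem_Icc ⟨by linarith [hθ.1], hθ.2⟩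
    have hc1 : Real.cos θ ≤ π/2 - θ := by
      rw [← Real.sin_pi_div_two_sub]; exact Real.sin_le (by linarith [hθ.2])
    have h1 : 1 - m * Real.sin θ ^ 2 ≤ (π/2 + ε - θ)^2 := by
      have := Real.sin_sq_add_cos_sq θ
      have hs : Real.sin θ ^ 2 ≤ 1 := Real.sin_sq_le_one θ
      have : 1 - m * Real.sin θ ^ 2 = Real.cos θ ^ 2 + ε^2 * Real.sin θ ^ 2 := by
        rw [hε2]; linear_combination -this
      have h5 : (Real.cos θ + ε)^2 ≤ (π/2 + ε - θ)^2 := by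
        apply pow_le_pow_left₀ (by positivity); linarith
      nlinarith [mul_nonneg hc0 hε0.le, mul_le_mul_of_nonneg_left hs (sq_nonneg ε)]
    have h2 := Real.rpow_le_rpow_of_nonpos (z := (-1/2:ℝ)) (base_pos hm θ) h1 (by norm_num)
    have h3 : ((π/2 + ε - θ) ^ 2) ^ (-1/2:ℝ) = (π/2 + ε - θ)⁻¹ := by
      rw [← Real.rpow_natCast, ← Real.rpow_mul (hy θ hθ).le]; norm_num [Real.rpow_neg_one]
    rw [h3] at h2
    simpa using h2
  rw [hI] at hle
  have h6 : 0 ≤ Real.log (π/2+ε) := Real.log_nonneg (by linarith [Real.pi_gt_three])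
  have h7 : Real.log (1 - m) = 2 * Real.log ε := by rw [← hε2, Real.log_pow]; norm_num
  linarith

lemma Gf_one : Tendsto Gf (𝓝[<] 1) atTop := by
  have h1 : Tendsto (fun m : ℝ => 1 - m) (𝓝[<] 1) (𝓝[>] 0) := by
    refine tendsto_nhdsWithin_iff.2 ⟨?_, ?_⟩
    · have : Tendsto (fun m : ℝ => 1 - m) (𝓝 1) (𝓝 (1 - 1)) := (continuous_const.sub continuous_id).tendsto 1
      rw [sub_self] at this
      exact this.mono_left nhdsWithin_le_nhds
    · filter_upwards [self_mem_nhdsWithin] with m (hm : m < 1)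
      exact sub_pos.2 hm
  have h2 : Tendsto (fun m : ℝ => -Real.log (1 - m) + (-4)) (𝓝[<] 1) atTop :=
    tendsto_atTop_add_const_right _ _
      (tendsto_neg_atBot_atTop.comp (Real.tendsto_log_nhdsGT_zero.comp h1))
  refine tendsto_atTop_mono' _ ?_ h2
  have : ∀ᶠ y in 𝓝[<] (1:ℝ), y ∈ Ioo (1/2:ℝ) 1 := Ioo_mem_nhdsLT (by norm_num)
  filter_upwards [this] with m hm
  have hm0 : 0 < m := by linarith [hm.1]
  have hm1 := hm.2
  have hK := Kf_ge hm0 hm1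
  have hC := Cf_pos hm1
  have hC1 := Cf_le hm1
  have hS := Sf_pos hm1
  rw [Gf_eq hm0 hm1, Nf_eq hm1]
  rw [Kf_eq hm1] at hK
  have ht : Sf m + Cf m - 1 ≤ Sf m / Cf m := by
    rw [le_div_iff₀ hC]
    nlinarith
  have e : m⁻¹ * (Sf m - Cf m) * (Sf m + Cf m) / (Cf m)^2 * (1 - m) =
      (Sf m / Cf m)^2 * ((1 - m) / m) - (1 - m) / m := by
    field_simp
    ring
  have h4 : (1 - m) / m ≤ 1 := by rw [div_le_one hm0]; linarith [hm.1]
  have h5 : 0 ≤ (Sf m / Cf m)^2 * ((1 - m) / m) := by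
    have : 0 < 1 - m := by linarith
    positivity
  rw [e]
  linarith

/-- Lemma 2.3: g(r) = [(K−E)(E−r'²K) + E((K−E) − (E−r'²K))]/(E−r'²K)² is strictly
increasing from (0,1) onto (3/2, ∞). -/
theorem stmt_9 :
    StrictMonoOn
      (fun r : ℝ =>
        ((ellipticK r - ellipticE r) * (ellipticE r - (1 - r^2) * ellipticK r) +
          ellipticE r * ((ellipticK r - ellipticE r) - (ellipticE r - (1 - r^2) * ellipticK r))) /
        (ellipticE r - (1 - r^2) * ellipticK r)^2) (Ioo 0 1) ∧
    Tendsto (fun r : ℝ =>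
        ((ellipticK r - ellipticE r) * (ellipticE r - (1 - r^2) * ellipticK r) +
          ellipticE r * ((ellipticK r - ellipticE r) - (ellipticE r - (1 - r^2) * ellipticK r))) /
        (ellipticE r - (1 - r^2) * ellipticK r)^2)
      (𝓝[>] 0) (𝓝 (3/2)) ∧
    Tendsto (fun r : ℝ =>
        ((ellipticK r - ellipticE r) * (ellipticE r - (1 - r^2) * ellipticK r) +
          ellipticE r * ((ellipticK r - ellipticE r) - (ellipticE r - (1 - r^2) * ellipticK r))) /
        (ellipticE r - (1 - r^2) * ellipticK r)^2)
      (𝓝[<] 1) atTop := by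
  have e : (fun r : ℝ =>
        ((ellipticK r - ellipticE r) * (ellipticE r - (1 - r^2) * ellipticK r) +
          ellipticE r * ((ellipticK r - ellipticE r) - (ellipticE r - (1 - r^2) * ellipticK r))) /
        (ellipticE r - (1 - r^2) * ellipticK r)^2) = fun r => Gf (r^2) := by
    ext r
    rw [ellipticK_eq, ellipticE_eq, Gf]
  rw [e]
  have hsq : ContinuousAt (fun r : ℝ => r^2) 0 := by fun_prop
  have hsq1 : ContinuousAt (fun r : ℝ => r^2) 1 := by fun_prop
  refine ⟨?_, ?_, ?_⟩
  · intro a ha b hb hab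
    have h1 : a ^ 2 < b ^ 2 := pow_lt_pow_left₀ hab ha.1.le (by norm_num)
    exact Gf_mono ⟨pow_pos ha.1 2, pow_lt_one₀ ha.1.le ha.2 (by norm_num)⟩
      ⟨pow_pos hb.1 2, pow_lt_one₀ hb.1.le hb.2 (by norm_num)⟩ h1
  · refine Gf_zero.comp (tendsto_nhdsWithin_iff.2 ⟨?_, ?_⟩)
    · have := hsq.tendsto
      norm_num at this
      exact this.mono_left nhdsWithin_le_nhds
    · filter_upwards [self_mem_nhdsWithin] with r (hr : 0 < r)
      exact pow_pos hr 2
  · refine Gf_one.comp (tendsto_nhdsWithin_iff.2 ⟨?_, ?_⟩)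
    · have := hsq1.tendsto
      norm_num at this
      exact this.mono_left nhdsWithin_le_nhds
    · have : ∀ᶠ y in 𝓝[<] (1:ℝ), y ∈ Ioo (0:ℝ) 1 := Ioo_mem_nhdsLT (by norm_num)
      filter_upwards [this] with r hr
      exact pow_lt_one₀ hr.1.le hr.2 (by norm_num)
end

section
/- For every p ∈ [1/2, 2], the double inequality 1/(4p) < (4/π)^{1/p} − 1 < 1/(4p − 1) holds. -/
open Real Set

/-- Lemma 2.5: the inequality 1/(4p) < (4/π)^{1/p} − 1 < 1/(4p−1) holds for p ∈ [1/2, 2]. -/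
theorem stmt_11 (p : ℝ) (hp : p ∈ Icc (1/2:ℝ) 2) :
    1/(4*p) < (4/π)^(1/p) - 1 ∧ (4/π)^(1/p) - 1 < 1/(4*p - 1) := by
  obtain ⟨h1, h2⟩ := hp
  have hp0 : 0 < p := by linarith
  have hpi := Real.pi_pos
  have hq : 0 < 4/π := by positivity
  have hL1 : Real.log (4/π) < 1/4 := by
    rw [Real.log_lt_iff_lt_exp hq]
    have h := Real.quadratic_le_exp_of_nonneg (x := 1/4) (by norm_num)
    refine lt_of_lt_of_le ?_ h
    rw [div_lt_iff₀ hpi]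
    nlinarith [Real.pi_gt_d4]
  have hL2 : 0.237 < Real.log (4/π) := by
    rw [Real.lt_log_iff_exp_lt hq]
    have h := Real.add_one_le_exp (-(0.237/8:ℝ))
    have h8 := pow_le_pow_left₀ (by norm_num) h 8
    rw [← Real.exp_nat_mul] at h8
    have e : ((8:ℕ):ℝ) * -(0.237/8:ℝ) = -0.237 := by norm_num
    rw [e, Real.exp_neg] at h8
    have h9 : (3.1416/4:ℝ) < (Real.exp 0.237)⁻¹ := lt_of_lt_of_le (by norm_num) h8
    have h10 : π / 4 < (Real.exp 0.237)⁻¹ := by linarith [Real.pi_lt_d4]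
    have := (lt_inv_comm₀ (by positivity) (Real.exp_pos _)).1 h10
    rwa [inv_div] at this
  set L := Real.log (4/π)
  have hx : (4/π)^(1/p) = Real.exp (L * (1/p)) := Real.rpow_def_of_pos hq _
  rw [hx]
  have hxl : 1/2 ≤ 1/p := one_div_le_one_div_of_le hp0 h2
  have hm : 1/(4*p) = (1/p)/4 := by field_simp
  have hu : 1/(4*p-1) = (1 - (1/p)/4)⁻¹ - 1 := by
    have : 4*p-1 ≠ 0 := by linarith
    have h3 : 1 - (1/p)/4 = (4*p-1)/(4*p) := by field_simp
    rw [h3, inv_div]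
    field_simp
    ring
  have hxu : 1/p ≤ 2 := by
    rw [div_le_iff₀ hp0]; linarith
  rw [hm, hu]
  generalize 1/p = x at *
  constructor
  · have h := Real.quadratic_le_exp_of_nonneg (x := L*x) (by nlinarith)
    have a1 : 0.237 * x ≤ L * x := by nlinarith
    have a2 : (0.237*x)^2 ≤ (L*x)^2 := pow_le_pow_left₀ (by linarith) a1 2
    nlinarith
  · have h := Real.add_one_le_exp (-(L*x))
    have h3 : 1 - x/4 < Real.exp (-(L*x)) := by nlinarith
    rw [Real.exp_neg] at h3
    have := (lt_inv_comm₀ (by linarith) (Real.exp_pos _)).1 h3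
    linarith
end

section
/- Let u ∈ [0, 1], p ∈ [1/2, 2], and define f_{u,p}(r) = p·log(1 + u r²) − log((2/π)(2E(r) − r'² K(r))) for r ∈ (0,1). Then f_{u,p}(r) < 0 for all r ∈ (0,1) if and only if u ≤ 1/(4p), and f_{u,p}(r) > 0 for all r ∈ (0,1) if and only if u ≥ (4/π)^{1/p} − 1. -/
open Real Set Filter Topology

noncomputable def wD (x θ : ℝ) : ℝ := Real.sqrt (1 - x * Real.sin θ ^ 2)

noncomputable def gI (x : ℝ) : ℝ :=
  ∫ θ in (0:ℝ)..(π/2), x * Real.cos θ ^ 2 / (1 + wD x θ)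

noncomputable def kI (x : ℝ) : ℝ :=
  ∫ θ in (0:ℝ)..(π/2), Real.cos θ ^ 2 * Real.sin θ ^ 4 * ((3 + wD x θ) / (8 * (1 + wD x θ) ^ 3))

lemma wD_nonneg (x θ : ℝ) : 0 ≤ wD x θ := Real.sqrt_nonneg _

lemma wD_cont2 : Continuous (fun q : ℝ × ℝ => wD q.1 q.2) := by
  unfold wD; fun_prop

lemma wD_cont (x : ℝ) : Continuous (wD x) := by
  unfold wD; fun_prop

lemma arg_pos {x : ℝ} (h0 : 0 < x) (h1 : x < 1) (θ : ℝ) : 0 < 1 - x * Real.sin θ ^ 2 := by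
  nlinarith [Real.sin_sq_le_one θ, sq_nonneg (Real.sin θ)]

lemma wD_sq {x : ℝ} (h0 : 0 < x) (h1 : x ≤ 1) (θ : ℝ) : wD x θ ^ 2 = 1 - x * Real.sin θ ^ 2 := by
  unfold wD
  rw [Real.sq_sqrt]
  nlinarith [Real.sin_sq_le_one θ, sq_nonneg (Real.sin θ)]

lemma wD_pos {x : ℝ} (h0 : 0 < x) (h1 : x < 1) (θ : ℝ) : 0 < wD x θ :=
  Real.sqrt_pos.2 (arg_pos h0 h1 θ)

lemma gI_cont : Continuous gI := by
  unfold gI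
  apply intervalIntegral.continuous_parametric_intervalIntegral_of_continuous'
  have := wD_cont2
  apply Continuous.div
  · fun_prop
  · exact continuous_const.add this
  · rintro ⟨x, θ⟩
    have := wD_nonneg x θ
    simp only
    positivity

lemma wD_deriv {x : ℝ} (h0 : 0 < x) (h1 : x < 1) (θ : ℝ) :
    HasDerivAt (wD x) (-(x * Real.sin θ * Real.cos θ) / wD x θ) θ := by
  have h := (((Real.hasDerivAt_sin θ).pow 2).const_mul x).const_sub 1
  have h2 := h.sqrt (arg_pos h0 h1 θ).ne'
  refine HasDerivAt.congr_deriv (f := wD x) h2 ?_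
  have hw := (wD_pos h0 h1 θ).ne'
  change _ / (2 * wD x θ) = _
  field_simp
  simp
  ring

lemma EK_eq {r : ℝ} (hr : r ∈ Ioo (0:ℝ) 1) :
    2 * ellipticE r - (1 - r^2) * ellipticK r = π / 2 + gI (r^2) := by
  obtain ⟨hr0, hr1⟩ := hr
  have h0 : 0 < r^2 := by positivity
  have h1 : r^2 < 1 := by nlinarith
  set x := r^2 with hx
  have hE : ellipticE r = ∫ θ in (0:ℝ)..(π/2), wD x θ := rfl
  have hK : ellipticK r = ∫ θ in (0:ℝ)..(π/2), (wD x θ)⁻¹ := by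
    unfold ellipticK
    congr 1
    ext θ
    rw [← hx, neg_div, Real.rpow_neg (arg_pos h0 h1 θ).le, ← Real.sqrt_eq_rpow]
    rfl
  have hwc := wD_cont x
  have hne : ∀ θ, wD x θ ≠ 0 := fun θ => (wD_pos h0 h1 θ).ne'
  have hne1 : ∀ θ, 1 + wD x θ ≠ 0 := fun θ => by have := wD_pos h0 h1 θ; positivity
  have hic : Continuous fun θ => (wD x θ)⁻¹ := hwc.inv₀ hne
  have hgc : Continuous fun θ => x * Real.cos θ ^ 2 / (1 + wD x θ) :=
    Continuous.div (by fun_prop) (by fun_prop) hne1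
  have hW : ∀ θ, HasDerivAt (fun t => t + x * Real.sin t * Real.cos t / (1 + wD x t))
      (2 * wD x θ - (1 - x) * (wD x θ)⁻¹ - x * Real.cos θ ^ 2 / (1 + wD x θ)) θ := by
    intro θ
    have h := (hasDerivAt_id θ).add
      ((((Real.hasDerivAt_sin θ).const_mul x).mul (Real.hasDerivAt_cos θ)).div
        ((wD_deriv h0 h1 θ).const_add 1) (hne1 θ))
    refine h.congr_deriv ?_
    clear h
    simp only [Pi.mul_apply]
    have a := hne θ
    have b := hne1 θ
    have hs := wD_sq h0 h1.le θ
    have hc := Real.sin_sq_add_cos_sq θ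
    generalize wD x θ = w at *
    generalize Real.sin θ = s at *
    generalize Real.cos θ = c at *
    have hX : x * c^2 = x - 1 + w^2 := by rw [hs]; linear_combination x * hc
    have hS : x * s^2 = 1 - w^2 := by rw [hs]; ring
    field_simp
    linear_combination (2*w*(1+w)+x*s^2)*hX + (x-1+w^2-w*(1+w))*hS
  have hint := intervalIntegral.integral_eq_sub_of_hasDerivAt (a := 0) (b := π/2)
    (fun θ _ => hW θ)
    ((((continuous_const.mul hwc).sub (continuous_const.mul hic)).sub hgc).intervalIntegrable _ _)
  rw [intervalIntegral.integral_sub, intervalIntegral.integral_sub,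
    intervalIntegral.integral_const_mul, intervalIntegral.integral_const_mul, ← hE, ← hK] at hint
  · simp at hint
    unfold gI
    linarith
  · exact (continuous_const.mul hwc).intervalIntegrable _ _
  · exact (continuous_const.mul hic).intervalIntegrable _ _
  · exact ((continuous_const.mul hwc).sub (continuous_const.mul hic)).intervalIntegrable _ _
  · exact hgc.intervalIntegrable _ _

lemma kI_cont (x : ℝ) : Continuous fun θ =>
    Real.cos θ ^ 2 * Real.sin θ ^ 4 * ((3 + wD x θ) / (8 * (1 + wD x θ) ^ 3)) := by
  have := wD_cont x
  apply Continuous.mul (by fun_prop)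
  apply Continuous.div (by fun_prop) (by fun_prop)
  intro θ
  have := wD_nonneg x θ
  positivity

lemma gI_eq {x : ℝ} (h0 : 0 < x) (h1 : x ≤ 1) :
    gI x = π / 2 * (x / 4 + x^2/64) + x^3 * kI x := by
  have e : gI x = ∫ θ in (0:ℝ)..(π/2), ((x/2 * Real.cos θ ^ 2 + x^2/8 * (Real.sin θ ^ 2 * Real.cos θ ^ 2))
      + x^3 * (Real.cos θ ^ 2 * Real.sin θ ^ 4 * ((3 + wD x θ) / (8 * (1 + wD x θ) ^ 3)))) := by
    unfold gI
    congr 1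
    ext θ
    have hs := wD_sq h0 h1 θ
    have hp : 1 + wD x θ ≠ 0 := by have := wD_nonneg x θ; positivity
    generalize wD x θ = w at *
    generalize Real.sin θ = s at *
    generalize Real.cos θ = c at *
    have : x * c^2 * (x^2 * s^4) = x * c^2 * (1-w^2)^2 := by rw [hs]; ring
    have h2 : x^3 * (c^2 * s^4 * ((3+w)/(8*(1+w)^3))) = x * c^2 * (1-w^2)^2 * ((3+w)/(8*(1+w)^3)) := by
      rw [← this]; ring
    have h3 : x^2/8 * (s^2*c^2) = x * c^2 * (1-w^2)/8 := by rw [hs]; ring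
    rw [h2, h3]
    field_simp
    ring
  rw [e, intervalIntegral.integral_add, intervalIntegral.integral_add,
    intervalIntegral.integral_const_mul, intervalIntegral.integral_const_mul,
    intervalIntegral.integral_const_mul, integral_cos_sq, integral_sin_sq_mul_cos_sq]
  · have : Real.sin (4 * (π/2)) = 0 := by
      rw [show 4 * (π/2) = 2 * π by ring]; exact Real.sin_two_pi
    simp [this]
    unfold kI
    ring
  · exact Continuous.intervalIntegrable (by fun_prop) _ _
  · exact Continuous.intervalIntegrable (by fun_prop) _ _
  · exact Continuous.intervalIntegrable (by fun_prop) _ _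
  · exact (continuous_const.mul (kI_cont x)).intervalIntegrable _ _

lemma kI_mono {x : ℝ} (h1 : x ≤ 1) : kI x ≤ kI 1 := by
  unfold kI
  apply intervalIntegral.integral_mono_on (by positivity)
    ((kI_cont x).intervalIntegrable _ _) ((kI_cont 1).intervalIntegrable _ _)
  intro θ _
  apply mul_le_mul_of_nonneg_left _ (by positivity)
  have hw : wD 1 θ ≤ wD x θ := by
    unfold wD
    apply Real.sqrt_le_sqrt
    nlinarith [sq_nonneg (Real.sin θ)]
  have h0 := wD_nonneg 1 θ
  generalize wD x θ = w at *
  generalize wD 1 θ = v at *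
  have hw0 : 0 ≤ w := h0.trans hw
  have e : ∀ t : ℝ, 0 ≤ t → (3 + t) / (8 * (1 + t)^3) = (1/8) * (1/(1+t)^2 + 2 / (1+t)^3) := by
    intro t ht
    field_simp
    ring
  rw [e w hw0, e v h0]
  gcongr

lemma kI_pos (x : ℝ) : 0 < kI x := by
  unfold kI
  apply intervalIntegral.intervalIntegral_pos_of_pos_on ((kI_cont x).intervalIntegrable _ _)
  · intro θ hθ
    have := wD_nonneg x θ
    have := Real.cos_pos_of_mem_Ioo ⟨by linarith [hθ.1, Real.pi_pos], hθ.2⟩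
    have := Real.sin_pos_of_mem_Ioo (x := θ) ⟨hθ.1, by linarith [hθ.2, Real.pi_pos]⟩
    positivity
  · positivity

lemma gI_one : gI 1 = 2 - π / 2 := by
  have h : ∀ θ ∈ uIcc (0:ℝ) (π/2), HasDerivAt (fun t => Real.sin t - t + Real.sin t / (1 + Real.cos t))
      (1 * Real.cos θ ^ 2 / (1 + wD 1 θ)) θ := by
    intro θ hθ
    rw [uIcc_of_le (by positivity)] at hθ
    have hc : 0 ≤ Real.cos θ := Real.cos_nonneg_of_mem_Icc ⟨by linarith [hθ.1, Real.pi_pos], hθ.2⟩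
    have hw : wD 1 θ = Real.cos θ := by
      unfold wD
      rw [show 1 - 1 * Real.sin θ ^ 2 = Real.cos θ ^ 2 by linarith [Real.sin_sq_add_cos_sq θ]]
      exact Real.sqrt_sq hc
    have hne : 1 + Real.cos θ ≠ 0 := by positivity
    rw [hw]
    have h := ((Real.hasDerivAt_sin θ).sub (hasDerivAt_id θ)).add
      ((Real.hasDerivAt_sin θ).div ((Real.hasDerivAt_cos θ).const_add 1) hne)
    refine h.congr_deriv ?_
    have hs := Real.sin_sq θ
    field_simp
    linear_combination hs
  have hc : Continuous fun θ => 1 * Real.cos θ ^ 2 / (1 + wD 1 θ) := by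
    have := wD_cont 1
    apply Continuous.div (by fun_prop) (by fun_prop)
    intro θ
    have := wD_nonneg 1 θ
    positivity
  unfold gI
  rw [intervalIntegral.integral_eq_sub_of_hasDerivAt h (hc.intervalIntegrable _ _)]
  simp
  ring

noncomputable def GG (x : ℝ) : ℝ := 1 + 2/π * gI x

lemma GG_one : GG 1 = 4/π := by
  unfold GG; rw [gI_one]; field_simp; ring

lemma GG_cont : Continuous GG := by
  have := gI_cont
  unfold GG; fun_prop

lemma GG_eq {x : ℝ} (h0 : 0 < x) (h1 : x ≤ 1) :
    GG x = (1 + x/8)^2 + x^3 * (2/π * kI x) := by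
  unfold GG; rw [gI_eq h0 h1]; field_simp; ring

lemma GG_lower {x : ℝ} (h0 : 0 < x) (h1 : x ≤ 1) : (1 + x/8)^2 < GG x := by
  rw [GG_eq h0 h1]
  have := kI_pos x
  have : 0 < x^3 * (2/π * kI x) := by positivity
  linarith

lemma GG_upper {x : ℝ} (h0 : 0 < x) (h1 : x ≤ 1) :
    GG x ≤ (1 + x/8)^2 + x^3 * (4/π - 81/64) := by
  have e := GG_eq one_pos le_rfl
  rw [GG_one] at e
  have : 4/π - 81/64 = 2/π * kI 1 := by rw [e]; ring
  rw [GG_eq h0 h1, this]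
  have := kI_mono h1
  gcongr

lemma four_pi : 4/π < 82/64 := by
  rw [div_lt_iff₀ Real.pi_pos]; nlinarith [Real.pi_gt_d2]

lemma four_pi' : 81/64 < 4/π := by
  rw [lt_div_iff₀ Real.pi_pos]; nlinarith [Real.pi_lt_d2]

lemma GG_upper2 {x b : ℝ} (h0 : 0 < x) (h1 : x < 1) (hb : 0 ≤ b) (hb2 : b^2 = 4/π) :
    GG x < ((1 - x) + x * b)^2 := by
  have h := GG_upper h0 h1.le
  rw [← hb2] at h
  have h9 : 9/8 < b := by
    have := four_pi'
    rw [← hb2] at this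
    nlinarith
  refine h.trans_lt ?_
  obtain ⟨d, hd, rfl⟩ : ∃ d, 0 < d ∧ b = 9/8 + d := ⟨b - 9/8, by linarith, by ring⟩
  have : ((1 - x) + x * (9/8+d))^2 - ((1 + x/8)^2 + x^3 * ((9/8+d)^2 - 81/64))
      = x * (1-x) * d * (2*(1+x) + x * (1/4 + d)) := by ring
  have h2 : 0 < x * (1-x) * d * (2*(1+x) + x * (1/4 + d)) := by
    have : 0 < 1 - x := by linarith
    positivity
  linarith

lemma arg_eq {r : ℝ} (hr : r ∈ Ioo (0:ℝ) 1) :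
    2/π * (2 * ellipticE r - (1 - r^2) * ellipticK r) = GG (r^2) := by
  rw [EK_eq hr]; unfold GG; field_simp

lemma forall_iff (P : ℝ → Prop) : (∀ r ∈ Ioo (0:ℝ) 1, P (r^2)) ↔ ∀ x ∈ Ioo (0:ℝ) 1, P x := by
  constructor
  · intro h x hx
    have := h (Real.sqrt x) ⟨Real.sqrt_pos.2 hx.1, by
      rw [Real.sqrt_lt' one_pos]; simpa using hx.2⟩
    rwa [Real.sq_sqrt hx.1.le] at this
  · intro h r hr
    exact h _ ⟨by have := hr.1; positivity, by nlinarith [hr.1, hr.2]⟩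

/-- Lemma 2.6: for u ∈ [0,1] and p ∈ [1/2,2], with
f_{u,p}(r) = p·log(1+ur²) − log((2/π)(2E(r) − r'²K(r))):
f_{u,p} < 0 on (0,1) iff u ≤ 1/(4p), and f_{u,p} > 0 on (0,1) iff u ≥ (4/π)^{1/p} − 1. -/
theorem stmt_13 (u p : ℝ) (hu : u ∈ Icc (0:ℝ) 1) (hp : p ∈ Icc (1/2:ℝ) 2) :
    ((∀ r ∈ Ioo (0:ℝ) 1,
        p * Real.log (1 + u * r^2) -
          Real.log (2/π * (2 * ellipticE r - (1 - r^2) * ellipticK r)) < 0) ↔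
      u ≤ 1/(4*p)) ∧
    ((∀ r ∈ Ioo (0:ℝ) 1,
        0 < p * Real.log (1 + u * r^2) -
          Real.log (2/π * (2 * ellipticE r - (1 - r^2) * ellipticK r))) ↔
      (4/π)^(1/p) - 1 ≤ u) := by
  obtain ⟨hu0, hu1⟩ := hu
  obtain ⟨hp0, hp2⟩ := hp
  have hpp : 0 < p := by linarith
  have e1 : (∀ r ∈ Ioo (0:ℝ) 1,
        p * Real.log (1 + u * r^2) -
          Real.log (2/π * (2 * ellipticE r - (1 - r^2) * ellipticK r)) < 0) ↔
      ∀ x ∈ Ioo (0:ℝ) 1, p * Real.log (1 + u * x) - Real.log (GG x) < 0 := by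
    rw [← forall_iff (fun x => p * Real.log (1 + u * x) - Real.log (GG x) < 0)]
    refine forall₂_congr fun r hr => ?_
    rw [arg_eq hr]
  have e2 : (∀ r ∈ Ioo (0:ℝ) 1,
        0 < p * Real.log (1 + u * r^2) -
          Real.log (2/π * (2 * ellipticE r - (1 - r^2) * ellipticK r))) ↔
      ∀ x ∈ Ioo (0:ℝ) 1, 0 < p * Real.log (1 + u * x) - Real.log (GG x) := by
    rw [← forall_iff (fun x => 0 < p * Real.log (1 + u * x) - Real.log (GG x))]
    refine forall₂_congr fun r hr => ?_
    rw [arg_eq hr]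
  rw [e1, e2]
  have hGpos : ∀ x : ℝ, 0 < x → x ≤ 1 → 0 < GG x := fun x h0 h1 =>
    lt_of_le_of_lt (by positivity) (GG_lower h0 h1)
  refine ⟨⟨fun h => ?_, fun h => ?_⟩, ⟨fun h => ?_, fun h => ?_⟩⟩
  · have key : ∀ x ∈ Ioo (0:ℝ) 1, p * u ≤ 1/4 + x := by
      rintro x ⟨h0, h1⟩
      have h2 := h x ⟨h0, h1⟩
      have h3 := Real.log_le_sub_one_of_pos (hGpos x h0 h1.le)
      have h4 := GG_upper h0 h1.le
      have hux : 0 < 1 + u * x := by positivity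
      have h5 := Real.one_sub_inv_le_log_of_pos hux
      have h6 : x^3 * (4/π - 81/64) ≤ x^2 * (1/64) := by
        have : x^3 ≤ x^2 := by nlinarith [sq_nonneg x]
        apply mul_le_mul this _ _ (by positivity)
        · linarith [four_pi]
        · linarith [four_pi']
      have h7 : p * (1 - (1 + u*x)⁻¹) ≤ x/4 + x^2/32 := by
        have := mul_le_mul_of_nonneg_left h5 hpp.le
        nlinarith
      have h8 : p * (1 - (1 + u*x)⁻¹) = x * (p * u) / (1 + u * x) := by
        field_simp; ring
      rw [h8, div_le_iff₀ hux] at h7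
      have h9 : p * u ≤ (1/4 + x/32) * (1 + u*x) := by
        apply le_of_mul_le_mul_left _ h0
        linarith
      have : u * x ≤ x := by nlinarith
      nlinarith
    rw [le_div_iff₀ (by positivity)]
    by_contra hc
    push Not at hc
    have hd : 0 < p * u - 1/4 := by linarith
    have := key (min (1/2) ((p*u-1/4)/2)) ⟨by positivity, by
      exact (min_le_left _ _).trans_lt (by norm_num)⟩
    have := min_le_right (1/2) ((p*u-1/4)/2)
    linarith
  · rintro x ⟨h0, h1⟩
    rw [sub_neg]
    have hux : 0 < 1 + u * x := by positivity
    have hb := rpow_one_add_le_one_add_mul_self (s := u * x) (p := p/2)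
      (by linarith [mul_nonneg hu0 h0.le]) (by linarith) (by linarith)
    rw [le_div_iff₀ (by positivity)] at h
    have h2 : (1 + u*x)^(p/2) ≤ 1 + x/8 := by nlinarith
    have h3 := Real.log_le_log (Real.rpow_pos_of_pos hux _) h2
    rw [Real.log_rpow hux] at h3
    have h4 := Real.log_lt_log (by positivity) (GG_lower h0 h1.le)
    rw [Real.log_pow] at h4
    push_cast at h4
    linarith
  · have hlim : 0 ≤ p * Real.log (1 + u * 1) - Real.log (GG 1) := by
      have hc : ContinuousAt (fun x => p * Real.log (1 + u * x) - Real.log (GG x)) 1 := by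
        have hG := GG_cont.continuousAt (x := 1)
        refine ContinuousAt.sub (continuousAt_const.mul (ContinuousAt.log (by fun_prop) (by positivity)))
          (hG.log (hGpos 1 one_pos le_rfl).ne')
      have ht := hc.tendsto.mono_left (nhdsWithin_le_nhds (s := Iio 1))
      refine ge_of_tendsto ht ?_
      filter_upwards [Ioo_mem_nhdsLT (show (0:ℝ) < 1 by norm_num)] with x hx
      exact (h x hx).le
    rw [GG_one, mul_one] at hlim
    have hu' : 0 < 1 + u := by linarith
    have h4 : 0 < 4/π := by positivity
    have : (4/π)^(1/p) ≤ 1 + u := by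
      rw [← Real.log_le_log_iff (Real.rpow_pos_of_pos h4 _) hu', Real.log_rpow h4, one_div,
        inv_mul_le_iff₀ hpp]
      linarith
    linarith
  · rintro x ⟨h0, h1⟩
    rw [sub_pos]
    have h4 : 0 < 4/π := by positivity
    set a := (4/π)^(1/p) with ha
    have ha0 : 0 < a := Real.rpow_pos_of_pos h4 _
    have hcc := Real.concaveOn_rpow (p := p/2) (by linarith) (by linarith)
    have hconc := hcc.2 (show (1:ℝ) ∈ Ici (0:ℝ) by simp) (show a ∈ Ici (0:ℝ) from ha0.le)
      (show 0 ≤ 1 - x by linarith) h0.le (by ring)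
    simp only [smul_eq_mul, Real.one_rpow, mul_one] at hconc
    set b := a^(p/2) with hb
    have hb0 : 0 < b := Real.rpow_pos_of_pos ha0 _
    have hb2 : b^2 = 4/π := by
      rw [hb, ha, ← Real.rpow_mul h4.le, ← Real.rpow_natCast, ← Real.rpow_mul h4.le]
      rw [show 1/p * (p/2) * ((2:ℕ):ℝ) = 1 by push_cast; field_simp]
      exact Real.rpow_one _
    have h5 := GG_upper2 h0 h1 hb0.le hb2
    have h6 : (1 - x + x * a)^(p/2) ≤ (1 + u*x)^(p/2) := by
      apply Real.rpow_le_rpow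
      · have : 0 < 1 - x := by linarith
        positivity
      · nlinarith
      · linarith
    have hux : 0 < 1 + u * x := by positivity
    have hq : 0 < 1 - x + x * b := by
      have : 0 < 1 - x := by linarith
      positivity
    have h7 := Real.log_le_log hq (hconc.trans h6)
    rw [Real.log_rpow hux] at h7
    have h8 := Real.log_lt_log (hGpos x h0 h1.le) h5
    rw [Real.log_pow] at h8
    push_cast at h8
    linarith
end

section
/- For all t ∈ (0,1), the inequality (8/π²)(2E(t) − t'² K(t))² > 1 + t² holds. -/
open Real Set Filter Topology

/-- Inequality (3.3): (8/π²)(2E(t) − t'²K(t))² > 1 + t² for all t ∈ (0,1). -/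
theorem stmt_15 (t : ℝ) (ht : t ∈ Ioo (0:ℝ) 1) :
    1 + t^2 < 8/π^2 * (2 * ellipticE t - (1 - t^2) * ellipticK t)^2 := by
  obtain ⟨h0, h1⟩ := ht
  have ht2 : t^2 < 1 := by nlinarith
  have ht0 : 0 < t^2 := by positivity
  have hs : ∀ θ : ℝ, Real.sin θ ^ 2 ≤ 1 := fun θ => Real.sin_sq_le_one θ
  have hpos : ∀ θ : ℝ, 0 < 1 - t^2 * Real.sin θ ^ 2 := fun θ => by
    nlinarith [hs θ, sq_nonneg (Real.sin θ)]
  have hcE : Continuous fun θ : ℝ => Real.sqrt (1 - t^2 * Real.sin θ ^ 2) := by fun_prop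
  have hcK : Continuous fun θ : ℝ => (1 - t^2 * Real.sin θ ^ 2) ^ (-(1:ℝ)/2) := by
    apply Continuous.rpow_const (by fun_prop)
    intro θ
    exact Or.inl (hpos θ).ne'
  have hcE2 : Continuous fun θ : ℝ => 2 * Real.sqrt (1 - t^2 * Real.sin θ ^ 2) := by fun_prop
  have hcK2 : Continuous fun θ : ℝ => (1 - t^2) * (1 - t^2 * Real.sin θ ^ 2) ^ (-(1:ℝ)/2) :=
    continuous_const.mul hcK
  have key : π/2 ≤ 2 * ellipticE t - (1 - t^2) * ellipticK t := by
    unfold ellipticE ellipticK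
    rw [← intervalIntegral.integral_const_mul, ← intervalIntegral.integral_const_mul,
      ← intervalIntegral.integral_sub
        (hcE2.intervalIntegrable _ _)
        (hcK2.intervalIntegrable _ _)]
    have hI : ∫ θ in (0:ℝ)..(π/2), ((1 + t^2) - 2 * t^2 * Real.sin θ ^ 2) = π/2 := by
      rw [intervalIntegral.integral_sub
        (by apply Continuous.intervalIntegrable; fun_prop)
        (by apply Continuous.intervalIntegrable; fun_prop),
        intervalIntegral.integral_const_mul, integral_sin_sq]
      simp
      ring
    refine hI.symm.le.trans ?_
    apply intervalIntegral.integral_mono_on (by positivity)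
      (by apply Continuous.intervalIntegrable; fun_prop)
      (by apply Continuous.intervalIntegrable; exact hcE2.sub hcK2)
    intro θ _
    have hp := hpos θ
    have e : (1 - t^2 * Real.sin θ ^ 2) ^ (-(1:ℝ)/2) = (Real.sqrt (1 - t^2 * Real.sin θ ^ 2))⁻¹ := by
      rw [neg_div, Real.rpow_neg hp.le, Real.sqrt_eq_rpow]
    simp only [e]
    set w := Real.sqrt (1 - t^2 * Real.sin θ ^ 2) with hw
    have hw0 : 0 < w := Real.sqrt_pos.mpr hp
    have hw2 : w^2 = 1 - t^2 * Real.sin θ ^ 2 := Real.sq_sqrt hp.le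
    have hw1 : w ≤ 1 := by nlinarith [mul_nonneg ht0.le (sq_nonneg (Real.sin θ))]
    have hA : 0 ≤ 1 + t^2 - 2 * t^2 * Real.sin θ ^ 2 := by
      nlinarith [hs θ]
    have e2 : 2 * w - (1 - t^2) * w⁻¹ = (1 + t^2 - 2 * t^2 * Real.sin θ ^ 2) / w := by
      field_simp
      rw [hw2]; ring
    rw [e2]
    exact le_div_self hA hw0 hw1
  have hpi := Real.pi_pos
  have hsq : (π/2)^2 ≤ (2 * ellipticE t - (1 - t^2) * ellipticK t)^2 := by gcongr
  calc 1 + t^2 < 2 := by linarith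
    _ = 8/π^2 * (π/2)^2 := by field_simp; norm_num
    _ ≤ _ := by gcongr
end

section
/- Let a, b > 0 with a ≠ b, let T(a,b) be the Toader mean, let A(a,b) = (a+b)/2 and C(a,b) = (a² + b²)/(a+b), and for t ∈ [1/2,1] and p ∈ [1/2,2] define Q_{t,p}(a,b) = C(ta + (1−t)b, tb + (1−t)a)^p · A(a,b)^{1−p}. Then for t₁, t₂ ∈ [1/2, 1] and p ∈ [1/2, 2], the double inequality Q_{t₁,p}(a,b) < T(a,b) < Q_{t₂,p}(a,b) holds for all a, b > 0 with a ≠ b if and only if t₁ ≤ 1/2 + √(1/(4p))/2 and t₂ ≥ 1/2 + √((4/π)^{1/p} − 1)/2. -/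
open Real Set

/-- The Toader mean T(a,b) = (2/π)∫₀^{π/2} √(a²cos²θ + b²sin²θ) dθ. -/
noncomputable def toaderMean (a b : ℝ) : ℝ :=
  2/π * ∫ θ in (0:ℝ)..(π/2), Real.sqrt (a^2 * Real.cos θ ^ 2 + b^2 * Real.sin θ ^ 2)

/-- Q_{t,p}(a,b) = C(ta+(1−t)b, tb+(1−t)a)^p · A(a,b)^{1−p}, where A(a,b) = (a+b)/2 is
the arithmetic mean and C(a,b) = (a²+b²)/(a+b) is the contraharmonic mean. -/
noncomputable def Q (t p a b : ℝ) : ℝ :=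
  (((t*a + (1 - t)*b)^2 + (t*b + (1 - t)*a)^2) / ((t*a + (1 - t)*b) + (t*b + (1 - t)*a)))^p *
    ((a + b)/2)^(1 - p)

noncomputable def bc (n : ℕ) : ℝ := Ring.choose (1/2 : ℝ) n

lemma bc0 : bc 0 = 1 := by simp [bc]
lemma bc1 : bc 1 = 1/2 := by simp [bc]
lemma bc2 : bc 2 = -1/8 := by
  simp [bc, Ring.choose_eq_smul, descPochhammer_succ_right, Nat.factorial, ← Polynomial.aeval_eq_smeval]; norm_num
lemma bc3 : bc 3 = 1/16 := by
  simp [bc, Ring.choose_eq_smul, descPochhammer_succ_right, Nat.factorial, ← Polynomial.aeval_eq_smeval, map_ofNat]; norm_num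

lemma bc_hasSum (z : ℂ) (hz : ‖z‖ < 1) :
    HasSum (fun n => (bc n : ℂ) * z ^ n) ((1 + z) ^ (1/2 : ℂ)) := by
  have h := (Complex.one_add_cpow_hasFPowerSeriesOnBall_zero (a := (1/2 : ℂ))).hasSum
    (y := z) (by
      rw [Metric.mem_eball, edist_zero_right, ← ofReal_norm]; exact ENNReal.ofReal_lt_one.2 hz)
  simp only [zero_add, binomialSeries_apply, List.ofFn_const, List.prod_replicate, smul_eq_mul] at h
  have e : ∀ n, (bc n : ℂ) = Ring.choose (1/2 : ℂ) n := by
    intro n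
    rw [bc, Complex.ofReal_choose]; norm_num
  simpa only [e] using h

lemma bc_summable (v : ℝ) (hv : |v| < 1) : Summable (fun n => |bc n| * |v| ^ n) := by
  have h := (bc_hasSum (v : ℂ) (by simpa using hv)).summable.norm
  simpa using h

lemma ser1 (v θ : ℝ) (hv : |v| < 1) :
    HasSum (fun q : ℕ × ℕ => bc q.1 * bc q.2 * v ^ (q.1 + q.2) * Real.cos (2 * ((q.1:ℝ) - q.2) * θ))
      (Real.sqrt ((1 + v)^2 * Real.cos θ ^ 2 + (1 - v)^2 * Real.sin θ ^ 2)) := by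
  set z : ℂ := (v : ℂ) * Complex.exp ((2 * θ : ℝ) * Complex.I) with hz
  have hzn : ‖z‖ < 1 := by
    rw [hz, norm_mul, Complex.norm_exp_ofReal_mul_I]; simpa using hv
  have h1 := bc_hasSum z hzn
  have h2 := h1.map (starRingEnd ℂ) Complex.continuous_conj
  have hs := summable_mul_of_summable_norm h1.summable.norm h2.summable.norm
  have h3 := (h1.mul h2 hs)
  have h4 := Complex.hasSum_re h3
  convert h4 using 1
  · funext q
    have e1 : ∀ n : ℕ, z ^ n = (v ^ n : ℝ) * Complex.exp ((2 * θ * n : ℝ) * Complex.I) := by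
      intro n
      rw [hz, mul_pow, ← Complex.exp_nat_mul]; push_cast; ring_nf
    simp only [Function.comp, map_mul, Complex.conj_ofReal, map_pow]
    rw [← map_pow, e1, e1, map_mul, Complex.conj_ofReal, ← Complex.exp_conj]
    simp only [map_mul, Complex.conj_ofReal, Complex.conj_I]
    have : (bc q.1 : ℂ) * ((v ^ q.1 : ℝ) * Complex.exp ((2 * θ * q.1 : ℝ) * Complex.I)) *
        ((bc q.2 : ℂ) * ((v ^ q.2 : ℝ) * Complex.exp ((2 * θ * q.2 : ℝ) * -Complex.I)))
        = ((bc q.1 * bc q.2 * v ^ (q.1 + q.2) : ℝ) : ℂ) *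
          Complex.exp ((2 * ((q.1:ℝ) - q.2) * θ : ℝ) * Complex.I) := by
      have : Complex.exp ((2 * ((q.1:ℝ) - q.2) * θ : ℝ) * Complex.I) =
          Complex.exp ((2 * θ * q.1 : ℝ) * Complex.I) * Complex.exp ((2 * θ * q.2 : ℝ) * -Complex.I) := by
        rw [← Complex.exp_add]; push_cast; ring_nf
      rw [this]; push_cast; ring
    rw [this, Complex.re_ofReal_mul, Complex.exp_ofReal_mul_I_re]
  · rw [Complex.mul_conj, Complex.ofReal_re, Complex.normSq_eq_norm_sq, ← norm_pow, one_div,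
      show (2:ℂ) = ((2:ℕ):ℂ) by simp, Complex.cpow_nat_inv_pow _ (by norm_num), Complex.norm_def]
    congr 1
    rw [Complex.normSq_apply, hz]
    have r1 : (1 + (v:ℂ) * Complex.exp ((2 * θ : ℝ) * Complex.I)).re = 1 + v * Real.cos (2*θ) := by
      rw [Complex.add_re, Complex.re_ofReal_mul, Complex.exp_ofReal_mul_I_re]; simp
    have r2 : (1 + (v:ℂ) * Complex.exp ((2 * θ : ℝ) * Complex.I)).im = v * Real.sin (2*θ) := by
      rw [Complex.add_im, Complex.im_ofReal_mul, Complex.exp_ofReal_mul_I_im]; simp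
    rw [r1, r2, Real.cos_two_mul, Real.sin_two_mul]
    have hc := Real.sin_sq θ
    have : (v * (2 * Real.sin θ * Real.cos θ)) * (v * (2 * Real.sin θ * Real.cos θ)) =
      4 * v^2 * Real.sin θ ^ 2 * Real.cos θ ^2 := by ring
    rw [this, hc]; ring

lemma cosint (k : ℤ) (hk : k ≠ 0) : ∫ θ in (0:ℝ)..(π/2), Real.cos (2 * (k:ℝ) * θ) = 0 := by
  have hk' : (2 * (k:ℝ)) ≠ 0 := by simpa using hk
  rw [intervalIntegral.integral_comp_mul_left (fun x => Real.cos x) hk', integral_cos]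
  rw [show 2 * (k:ℝ) * (π/2) = k * π by ring, Real.sin_int_mul_pi]; simp

lemma toader_hasSum (v : ℝ) (hv : |v| < 1) :
    HasSum (fun n => bc n ^ 2 * (v ^ 2) ^ n) (toaderMean (1 + v) (1 - v)) := by
  have hs := bc_summable v hv
  have hb : Summable (fun q : ℕ × ℕ => (|bc q.1| * |v| ^ q.1) * (|bc q.2| * |v| ^ q.2)) :=
    hs.mul_of_nonneg hs (fun n => by positivity) (fun n => by positivity)
  have h : HasSum (fun q : ℕ × ℕ => ∫ θ in (0:ℝ)..(π/2),
      bc q.1 * bc q.2 * v ^ (q.1 + q.2) * Real.cos (2 * ((q.1:ℝ) - q.2) * θ))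
      (∫ θ in (0:ℝ)..(π/2), Real.sqrt ((1 + v)^2 * Real.cos θ ^ 2 + (1 - v)^2 * Real.sin θ ^ 2)) := by
    refine intervalIntegral.hasSum_integral_of_dominated_convergence
      (fun q _ => (|bc q.1| * |v| ^ q.1) * (|bc q.2| * |v| ^ q.2)) ?_ ?_ ?_ ?_ ?_
    · intro q
      apply Continuous.aestronglyMeasurable; fun_prop
    · intro q
      filter_upwards with θ _
      rw [norm_mul, norm_mul, norm_mul, norm_pow]
      simp only [Real.norm_eq_abs]
      calc _ ≤ |bc q.1| * |bc q.2| * |v| ^ (q.1 + q.2) * 1 := by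
            gcongr; exact Real.abs_cos_le_one _
        _ = _ := by rw [pow_add]; ring
    · filter_upwards with θ _
      exact hb
    · simp
    · filter_upwards with θ _
      exact ser1 v θ hv
  have inj : Function.Injective (fun n : ℕ => ((n, n) : ℕ × ℕ)) := fun a b hab => by simpa using hab
  have hz : ∀ q ∉ Set.range (fun n : ℕ => ((n, n) : ℕ × ℕ)), (∫ θ in (0:ℝ)..(π/2),
      bc q.1 * bc q.2 * v ^ (q.1 + q.2) * Real.cos (2 * ((q.1:ℝ) - q.2) * θ)) = 0 := by
    rintro ⟨m, n⟩ hmn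
    have hne : (m:ℤ) - n ≠ 0 := by
      intro h0
      apply hmn
      have : m = n := by omega
      exact ⟨m, by simp [this]⟩
    have := cosint _ hne
    push_cast at this
    rw [intervalIntegral.integral_const_mul]
    simp only [this, mul_zero]
  have h2 := ((inj.hasSum_iff hz).2 h).mul_left (2/π)
  have hpi := Real.pi_ne_zero
  have e : (fun n => bc n ^ 2 * (v ^ 2) ^ n) = fun n => 2/π * (((fun q : ℕ × ℕ => ∫ θ in (0:ℝ)..(π/2),
      bc q.1 * bc q.2 * v ^ (q.1 + q.2) * Real.cos (2 * ((q.1:ℝ) - q.2) * θ)) ∘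
      (fun n : ℕ => ((n, n) : ℕ × ℕ))) n) := by
    funext n
    simp only [Function.comp, sub_self, mul_zero, zero_mul, Real.cos_zero,
      intervalIntegral.integral_const, smul_eq_mul]
    field_simp
    ring
  rw [e]
  exact h2

open Filter Topology in
lemma toader_tendsto : Tendsto (fun v : ℝ => toaderMean (1 + v) (1 - v)) (𝓝[<] 1) (𝓝 (4/π)) := by
  have hc : Continuous (fun v : ℝ => toaderMean (1 + v) (1 - v)) := by
    unfold toaderMean
    refine continuous_const.mul ?_
    refine intervalIntegral.continuous_parametric_intervalIntegral_of_continuous' ?_ _ _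
    simp only [Function.uncurry_def]
    fun_prop
  have h1 : toaderMean (1 + 1) (1 - 1) = 4/π := by
    unfold toaderMean
    have : ∫ θ in (0:ℝ)..(π/2), Real.sqrt ((1+1)^2 * Real.cos θ ^ 2 + (1-1)^2 * Real.sin θ ^ 2)
        = ∫ θ in (0:ℝ)..(π/2), 2 * Real.cos θ := by
      apply intervalIntegral.integral_congr
      intro θ hθ
      rw [uIcc_of_le (by positivity)] at hθ
      have : 0 ≤ Real.cos θ := Real.cos_nonneg_of_mem_Icc ⟨by linarith [hθ.1, Real.pi_pos], hθ.2⟩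
      simp only
      rw [show ((1:ℝ)+1)^2 * Real.cos θ ^ 2 + (1-1)^2 * Real.sin θ ^ 2 = (2 * Real.cos θ)^2 by ring]
      exact Real.sqrt_sq (by positivity)
    rw [this, intervalIntegral.integral_const_mul, integral_cos]
    simp; ring
  have := hc.tendsto 1
  rw [h1] at this
  exact this.mono_left nhdsWithin_le_nhds

lemma toader_lower (v : ℝ) (hv : |v| < 1) (h0 : v ≠ 0) :
    1 + v^2/4 + (v^2)^2/64 < toaderMean (1 + v) (1 - v) := by
  have h := sum_le_hasSum (Finset.range 4) (fun n _ => by positivity) (toader_hasSum v hv)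
  simp only [Finset.sum_range_succ, Finset.sum_range_zero, bc0, bc1, bc2, bc3] at h
  have : 0 < v^2 := by positivity
  have : 0 < (v^2)^3 := by positivity
  linarith

open Filter Topology in
lemma bc_sum_le (N : ℕ) : ∑ n ∈ Finset.range N, bc n ^ 2 ≤ 4/π := by
  have h1 : Tendsto (fun v : ℝ => ∑ n ∈ Finset.range N, bc n ^ 2 * (v^2)^n) (𝓝[<] 1)
      (𝓝 (∑ n ∈ Finset.range N, bc n ^ 2)) := by
    have hc : Continuous (fun v : ℝ => ∑ n ∈ Finset.range N, bc n ^ 2 * (v^2)^n) := by fun_prop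
    have := hc.tendsto 1
    simp only [one_pow, mul_one] at this
    exact this.mono_left nhdsWithin_le_nhds
  refine le_of_tendsto_of_tendsto h1 toader_tendsto ?_
  filter_upwards [Ioo_mem_nhdsLT (show (0:ℝ) < 1 by norm_num)] with v hv
  exact sum_le_hasSum (Finset.range N) (fun n _ => by positivity)
    (toader_hasSum v (abs_lt.2 ⟨by linarith [hv.1], hv.2⟩))

open Filter Topology in
lemma toader_upper (v : ℝ) (hv : |v| < 1) :
    toaderMean (1 + v) (1 - v) ≤ 1 + v^2/4 + (4/π - 5/4) * (v^2)^2 := by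
  have h := (toader_hasSum v hv).tendsto_sum_nat
  have h2 := h.comp (tendsto_add_atTop_nat 2)
  refine le_of_tendsto h2 (Eventually.of_forall fun N => ?_)
  have hx : v^2 ≤ 1 := by rw [sq_le_one_iff_abs_le_one]; exact hv.le
  have hs := bc_sum_le (N+2)
  simp only [Function.comp]
  rw [Finset.sum_range_succ', Finset.sum_range_succ'] at hs ⊢
  have : ∑ k ∈ Finset.range N, bc (k + 1 + 1) ^ 2 * (v ^ 2) ^ (k + 1 + 1) ≤
      (∑ k ∈ Finset.range N, bc (k + 1 + 1) ^ 2) * (v^2)^2 := by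
    rw [Finset.sum_mul]
    refine Finset.sum_le_sum fun k _ => ?_
    have : (v ^ 2) ^ (k + 1 + 1) ≤ (v^2)^2 := pow_le_pow_of_le_one (by positivity) hx (by omega)
    gcongr
  simp only [zero_add, bc0, bc1] at hs ⊢
  have h3 : (∑ k ∈ Finset.range N, bc (k + 1 + 1) ^ 2) * (v^2)^2 ≤ (4/π - 5/4) * (v^2)^2 := by
    gcongr; linarith
  linarith

lemma toader_red (a b : ℝ) (ha : 0 < a) (hb : 0 < b) :
    toaderMean a b = (a+b)/2 * toaderMean (1 + (a-b)/(a+b)) (1 - (a-b)/(a+b)) := by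
  unfold toaderMean
  rw [mul_left_comm, ← intervalIntegral.integral_const_mul ((a+b)/2)]
  congr 1
  apply intervalIntegral.integral_congr
  intro θ _
  simp only
  have hA : 0 < (a+b)/2 := by positivity
  rw [← Real.sqrt_sq hA.le, ← Real.sqrt_mul (sq_nonneg _)]
  congr 1
  field_simp
  ring

lemma Q_red (t p a b : ℝ) (ha : 0 < a) (hb : 0 < b) :
    Q t p a b = (a+b)/2 * (1 + (2*t-1)^2 * ((a-b)/(a+b))^2)^p := by
  unfold Q
  have hA : 0 < (a+b)/2 := by positivity
  have : ((t*a + (1 - t)*b)^2 + (t*b + (1 - t)*a)^2) / ((t*a + (1 - t)*b) + (t*b + (1 - t)*a))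
     = (a+b)/2 * (1 + (2*t-1)^2 * ((a-b)/(a+b))^2) := by
    rw [show (t*a + (1 - t)*b) + (t*b + (1 - t)*a) = a + b by ring]
    field_simp
    ring
  rw [this, Real.mul_rpow hA.le (by positivity), mul_right_comm, ← Real.rpow_add hA]
  simp

/-- reduced statement -/
lemma red_iff (t₁ t₂ p : ℝ) : (∀ a b : ℝ, 0 < a → 0 < b → a ≠ b →
      Q t₁ p a b < toaderMean a b ∧ toaderMean a b < Q t₂ p a b) ↔
    ∀ v : ℝ, |v| < 1 → v ≠ 0 → (1 + (2*t₁-1)^2 * v^2)^p < toaderMean (1+v) (1-v) ∧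
      toaderMean (1+v) (1-v) < (1 + (2*t₂-1)^2 * v^2)^p := by
  constructor
  · intro h v hv h0
    have hv' := abs_lt.1 hv
    have ha : 0 < 1 + v := by linarith
    have hb : 0 < 1 - v := by linarith
    have := h (1+v) (1-v) ha hb (fun h => h0 (by linarith))
    rw [Q_red _ _ _ _ ha hb, Q_red _ _ _ _ ha hb,
      show (1 + v + (1 - v))/2 = 1 by ring,
      show (1 + v - (1 - v))/(1 + v + (1 - v)) = v by ring] at this
    simpa using this
  · intro h a b ha hb hab
    rw [Q_red _ _ _ _ ha hb, Q_red _ _ _ _ ha hb, toader_red a b ha hb]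
    have hA : 0 < (a+b)/2 := by positivity
    have := h ((a-b)/(a+b)) (by
      rw [abs_lt, lt_div_iff₀ (by positivity), div_lt_iff₀ (by positivity)]
      constructor <;> linarith) (div_ne_zero (sub_ne_zero.2 hab) (by positivity))
    exact ⟨mul_lt_mul_of_pos_left this.1 hA, mul_lt_mul_of_pos_left this.2 hA⟩

lemma suff_low (u p x : ℝ) (hp : p ∈ Icc (1/2:ℝ) 2) (hx : 0 < x) (hu0 : 0 ≤ u)
    (hu : u ≤ 1/(4*p)) : (1 + u * x)^p ≤ 1 + x/4 + x^2/64 := by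
  obtain ⟨hp1, hp2⟩ := hp
  have hp0 : 0 < p := by linarith
  have h1 : 1 + (2/p) * (x/8) ≤ (1 + x/8)^(2/p) :=
    one_add_mul_self_le_rpow_one_add (by linarith) (by rw [le_div_iff₀ hp0]; linarith)
  have h2 : 1 + u * x ≤ (1 + x/8)^(2/p) := by
    refine le_trans ?_ h1
    have : u * x ≤ 1/(4*p) * x := by gcongr
    have e : (2/p) * (x/8) = 1/(4*p) * x := by field_simp; ring
    linarith
  calc (1 + u * x)^p ≤ ((1 + x/8)^(2/p))^p := by
        apply Real.rpow_le_rpow (by positivity) h2 hp0.le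
    _ = (1 + x/8)^(2:ℝ) := by
        rw [← Real.rpow_mul (by positivity)]; congr 1; field_simp
    _ = 1 + x/4 + x^2/64 := by rw [Real.rpow_two]; ring

lemma suff_up (u p x : ℝ) (hp : p ∈ Icc (1/2:ℝ) 2) (hx : 0 < x) (hx1 : x < 1)
    (hu : (4/π)^(1/p) - 1 ≤ u) : 1 + x/4 + (4/π - 5/4) * x^2 < (1 + u * x)^p := by
  obtain ⟨hp1, hp2⟩ := hp
  have hp0 : 0 < p := by linarith
  set s := Real.sqrt (4/π) with hs
  have hpi := Real.pi_pos
  have hs2 : s^2 = 4/π := Real.sq_sqrt (by positivity)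
  have hs98 : 9/8 < s := by
    rw [hs]
    apply Real.lt_sqrt_of_sq_lt
    rw [lt_div_iff₀ hpi]
    have := Real.pi_lt_d2
    norm_num at this ⊢
    linarith
  have hq : 1 ≤ 2/p := by rw [le_div_iff₀ hp0]; linarith
  have hsq : s^(2/p) = (4/π)^(1/p) := by
    rw [← hs2, ← Real.rpow_two, ← Real.rpow_mul (by positivity)]; congr 1; ring
  have hconv : (1 + (s-1)*x)^(2/p) ≤ 1 + ((4/π)^(1/p) - 1) * x := by
    have h := (convexOn_rpow hq).2 (show (1:ℝ) ∈ Ici 0 by simp) (show s ∈ Ici 0 by simp; linarith)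
      (show 0 ≤ 1 - x by linarith) hx.le (by ring)
    simp only [smul_eq_mul, Real.one_rpow, hsq] at h
    rw [show (1 - x) * 1 + x * s = 1 + (s-1)*x by ring] at h
    linarith
  have hpos : 0 < 1 + (s-1)*x := by
    have : 0 < (s-1)*x := mul_pos (by linarith) hx
    linarith
  have h3 : (1 + (s-1)*x)^2 ≤ (1 + u*x)^p := by
    calc (1 + (s-1)*x)^2 = ((1 + (s-1)*x)^(2/p))^p := by
          rw [← Real.rpow_mul hpos.le, ← Real.rpow_two]; congr 1; field_simp
      _ ≤ _ := by
          apply Real.rpow_le_rpow (by positivity) _ hp0.le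
          have : ((4/π)^(1/p) - 1) * x ≤ u * x := by gcongr
          linarith
  refine lt_of_lt_of_le ?_ h3
  rw [← hs2]
  have : 0 < (2*(s-1) - 1/4) * (x * (1 - x)) := by
    apply mul_pos (by linarith) (mul_pos hx (by linarith))
  nlinarith

open Filter Topology in
lemma nec_low (u p : ℝ) (hp0 : 0 < p)
    (h : ∀ v : ℝ, |v| < 1 → v ≠ 0 → (1 + u * v^2)^p < toaderMean (1+v) (1-v)) :
    u ≤ 1/(4*p) := by
  have hd : HasDerivAt (fun x : ℝ => (1 + u * x)^p) (u * p) 0 := by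
    have h1 : HasDerivAt (fun x : ℝ => 1 + u * x) u 0 := by
      simpa using ((hasDerivAt_id (0:ℝ)).const_mul u).const_add 1
    have := h1.rpow_const (p := p) (by simp)
    simpa using this
  have hsl := hd.tendsto_slope_zero_right
  have ht : Tendsto (fun x : ℝ => 1/4 + (4/π - 5/4) * x) (𝓝[>] 0) (𝓝 (1/4)) := by
    have hc : Continuous (fun x : ℝ => 1/4 + (4/π - 5/4) * x) := by fun_prop
    have := hc.tendsto 0
    simp only [mul_zero, add_zero] at this
    exact this.mono_left nhdsWithin_le_nhds
  have hle := le_of_tendsto_of_tendsto hsl ht (by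
    filter_upwards [Ioo_mem_nhdsGT (show (0:ℝ) < 1 by norm_num)] with x hx
    have hsx : Real.sqrt x ^ 2 = x := Real.sq_sqrt hx.1.le
    have hv1 : |Real.sqrt x| < 1 := by
      rw [abs_of_nonneg (Real.sqrt_nonneg _), Real.sqrt_lt' one_pos]; simpa using hx.2
    have a1 := h (Real.sqrt x) hv1 (Real.sqrt_pos.2 hx.1).ne'
    have a2 := toader_upper (Real.sqrt x) hv1
    rw [hsx] at a1 a2
    simp only [zero_add, mul_zero, add_zero, Real.one_rpow, smul_eq_mul]
    rw [inv_mul_le_iff₀ hx.1]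
    linarith)
  rw [le_div_iff₀ (by positivity)]
  linarith

open Filter Topology in
lemma nec_up (u p : ℝ) (hp0 : 0 < p) (hu : 0 ≤ u)
    (h : ∀ v : ℝ, |v| < 1 → v ≠ 0 → toaderMean (1+v) (1-v) < (1 + u * v^2)^p) :
    (4/π)^(1/p) - 1 ≤ u := by
  have hc : Continuous (fun v : ℝ => (1 + u * v^2)^p) := by
    apply Continuous.rpow_const (by fun_prop)
    intro v; right; exact hp0.le
  have h1 := (hc.tendsto 1).mono_left (nhdsWithin_le_nhds (s := Iio 1))
  have hle := le_of_tendsto_of_tendsto toader_tendsto h1 (by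
    filter_upwards [Ioo_mem_nhdsLT (show (0:ℝ) < 1 by norm_num)] with v hv
    exact (h v (abs_lt.2 ⟨by linarith [hv.1], hv.2⟩) hv.1.ne').le)
  simp only [one_pow, mul_one] at hle
  have := Real.rpow_le_rpow (by positivity) hle (show 0 ≤ 1/p by positivity)
  rw [← Real.rpow_mul (by positivity), mul_one_div_cancel hp0.ne', Real.rpow_one] at this
  linarith

theorem stmt_16 (t₁ t₂ p : ℝ) (ht₁ : t₁ ∈ Icc (1/2:ℝ) 1) (ht₂ : t₂ ∈ Icc (1/2:ℝ) 1)
    (hp : p ∈ Icc (1/2:ℝ) 2) :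
    (∀ a b : ℝ, 0 < a → 0 < b → a ≠ b →
      Q t₁ p a b < toaderMean a b ∧ toaderMean a b < Q t₂ p a b) ↔
    (t₁ ≤ 1/2 + Real.sqrt (1/(4*p)) / 2 ∧ 1/2 + Real.sqrt ((4/π)^(1/p) - 1) / 2 ≤ t₂) := by
  have hp0 : 0 < p := by linarith [hp.1]
  have e1 : t₁ ≤ 1/2 + Real.sqrt (1/(4*p)) / 2 ↔ (2*t₁-1)^2 ≤ 1/(4*p) := by
    have h4 : 0 ≤ 1/(4*p) := by positivity
    have h5 : 0 ≤ 2*t₁-1 := by linarith [ht₁.1]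
    have h6 : 2*t₁-1 ≤ Real.sqrt (1/(4*p)) ↔ (2*t₁-1)^2 ≤ 1/(4*p) := by
      first | exact Real.le_sqrt h5 | exact Real.le_sqrt h4 | exact Real.le_sqrt h5 h4
    rw [← h6]
    constructor <;> intro h <;> linarith
  have e2 : 1/2 + Real.sqrt ((4/π)^(1/p) - 1) / 2 ≤ t₂ ↔ (4/π)^(1/p) - 1 ≤ (2*t₂-1)^2 := by
    rw [← Real.sqrt_le_left (by linarith [ht₂.1])]
    constructor <;> intro h <;> linarith
  rw [red_iff, e1, e2]
  constructor
  · intro h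
    exact ⟨nec_low _ p hp0 fun v hv h0 => (h v hv h0).1,
      nec_up _ p hp0 (sq_nonneg _) fun v hv h0 => (h v hv h0).2⟩
  · rintro ⟨h1, h2⟩ v hv h0
    have hx : 0 < v^2 := by positivity
    have hx1 : v^2 < 1 := by rw [sq_lt_one_iff_abs_lt_one]; exact hv
    exact ⟨lt_of_le_of_lt (suff_low _ p _ hp hx (sq_nonneg _) h1) (toader_lower v hv h0),
      lt_of_le_of_lt (toader_upper v hv) (suff_up _ p _ hp hx hx1 h2)⟩
end

section
/- For all r ∈ (0,1), the double inequality π(1+r')^{−3}([λ + (1−λ)r']² + [(1−λ) + λ r']²)² < E(r) < (π/2)·(([μ + (1−μ)r']² + [(1−μ) + μ r']²)/2)^{1/2} holds, where λ = 1/2 + √2/8 and μ = 1/2 + √((4/π)² − 1)/2. -/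
open Real Set Filter Topology

noncomputable def cc (n : ℕ) : ℝ := Ring.choose (1/2 : ℝ) n

lemma cc0 : cc 0 = 1 := by simp [cc]
lemma cc1 : cc 1 = 1/2 := by simp [cc]
lemma cc2 : cc 2 = -1/8 := by
  simp only [cc, Ring.choose_eq_smul]
  norm_num [descPochhammer_succ_right, Polynomial.smeval_mul, Polynomial.smeval_natCast, Nat.factorial]
lemma cc3 : cc 3 = 1/16 := by
  simp only [cc, Ring.choose_eq_smul]
  have h2 : Polynomial.smeval (2 : Polynomial ℤ) (1/2 : ℝ) = 2 := by
    have := Polynomial.smeval_natCast ℤ (1/2 : ℝ) 2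
    simpa using this
  norm_num [descPochhammer_succ_right, Polynomial.smeval_mul, Polynomial.smeval_natCast, Nat.factorial, h2]

lemma cc_hasSum (z : ℂ) (hz : ‖z‖ < 1) :
    HasSum (fun n => (cc n : ℂ) * z ^ n) ((1 + z) ^ (1/2 : ℂ)) := by
  have h := (Complex.one_add_cpow_hasFPowerSeriesOnBall_zero (a := (1/2:ℂ))).hasSum (y := z)
    (by
    rw [← ENNReal.ofReal_one, Metric.eball_ofReal]; simpa using hz)
  simp only [binomialSeries_apply, zero_add] at h
  have e : (fun n => (cc n : ℂ) * z ^ n) =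
      fun n => Ring.choose (1 / 2 : ℂ) n • (List.ofFn fun _ : Fin n => z).prod := by
    ext n
    simp [cc, Complex.ofReal_choose]
  rw [e]
  exact h

lemma cc_summable (t : ℝ) (h0 : 0 ≤ t) (h1 : t < 1) : Summable (fun n => |cc n| * t ^ n) := by
  have h := (cc_hasSum (t : ℂ) (by simpa [abs_of_nonneg h0] using h1)).summable.norm
  refine h.congr fun n => ?_
  simp [abs_of_nonneg h0]

noncomputable def II (t : ℝ) : ℝ := ∫ θ in (0:ℝ)..(π/2), √(1 + t^2 + 2 * t * Real.cos (2 * θ))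

lemma dbl (t : ℝ) (h0 : 0 ≤ t) (h1 : t < 1) (θ : ℝ) :
    HasSum (fun p : ℕ × ℕ => (cc p.1 * t ^ p.1) * (cc p.2 * t ^ p.2) *
      Real.cos (2 * ((p.1 : ℝ) - p.2) * θ)) (√(1 + t^2 + 2 * t * Real.cos (2 * θ))) := by
  set z : ℂ := t * Complex.exp ((2 * θ : ℝ) * Complex.I) with hz
  have hzn : ‖z‖ < 1 := by
    rw [hz, norm_mul, Complex.norm_exp_ofReal_mul_I]
    simpa [abs_of_nonneg h0] using h1
  have hs := cc_hasSum z hzn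
  set w := (1 + z) ^ (1/2 : ℂ) with hw
  have hw2 : w ^ 2 = 1 + z := by
    have := Complex.cpow_nat_inv_pow (1 + z) (n := 2) two_ne_zero
    rw [hw]; simpa using this
  have hsc : HasSum (fun n => (starRingEnd ℂ) ((cc n : ℂ) * z ^ n)) ((starRingEnd ℂ) w) :=
    hs.map (starRingEnd ℂ) Complex.continuous_conj
  have hsum := summable_mul_of_summable_norm hs.summable.norm hsc.summable.norm
  have hm := Complex.hasSum_re (hs.mul hsc hsum)
  have hval : (w * (starRingEnd ℂ) w).re = √(1 + t^2 + 2 * t * Real.cos (2 * θ)) := by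
    rw [Complex.mul_conj, Complex.ofReal_re, Complex.normSq_eq_norm_sq, ← norm_pow, hw2,
      Complex.norm_def]
    congr 1
    rw [Complex.normSq_apply, hz, Complex.exp_mul_I, ← Complex.ofReal_cos, ← Complex.ofReal_sin]
    simp only [Complex.add_re, Complex.one_re, Complex.mul_re, Complex.ofReal_re,
      Complex.ofReal_im, Complex.add_im, Complex.mul_im, Complex.I_re, Complex.I_im, Complex.one_im]
    nlinarith [Real.sin_sq_add_cos_sq (2 * θ)]
  rw [hval] at hm
  convert hm using 2 with p
  have e1 : ∀ n : ℕ, z ^ n = (t ^ n : ℝ) * Complex.exp ((n * (2 * θ) : ℝ) * Complex.I) := by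
    intro n
    rw [hz, mul_pow, ← Complex.exp_nat_mul]
    push_cast
    ring_nf
  rw [e1, e1, Complex.exp_mul_I, Complex.exp_mul_I, ← Complex.ofReal_cos, ← Complex.ofReal_sin,
    ← Complex.ofReal_cos, ← Complex.ofReal_sin]
  rw [show 2 * ((p.1 : ℝ) - p.2) * θ = p.1 * (2 * θ) - p.2 * (2 * θ) by ring, Real.cos_sub]
  simp only [map_mul, map_add, Complex.conj_ofReal, Complex.conj_I, Complex.add_re, Complex.mul_re,
    Complex.ofReal_re, Complex.neg_re, Complex.neg_im,
      Complex.ofReal_im, Complex.add_im, Complex.mul_im, Complex.I_re, Complex.I_im]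
  ring

lemma cos_int (n m : ℕ) (h : n ≠ m) :
    ∫ θ in (0:ℝ)..(π/2), Real.cos (2 * ((n : ℝ) - m) * θ) = 0 := by
  have hne : (2 * ((n : ℝ) - m)) ≠ 0 := by
    have : (n : ℝ) ≠ m := by exact_mod_cast h
    exact mul_ne_zero two_ne_zero (sub_ne_zero.mpr this)
  rw [intervalIntegral.integral_comp_mul_left (fun x => Real.cos x) hne, integral_cos]
  rw [show 2 * ((n : ℝ) - m) * (π / 2) = ((n - m : ℤ) : ℝ) * π by push_cast; ring,
    Real.sin_int_mul_pi]
  simp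

lemma II_hasSum (t : ℝ) (h0 : 0 ≤ t) (h1 : t < 1) :
    HasSum (fun n => cc n ^ 2 * (t ^ 2) ^ n) (2 / π * II t) := by
  have hb : Summable (fun p : ℕ × ℕ => (|cc p.1| * t ^ p.1) * (|cc p.2| * t ^ p.2)) :=
    (cc_summable t h0 h1).mul_of_nonneg (cc_summable t h0 h1)
      (fun n => by positivity) (fun n => by positivity)
  have h := intervalIntegral.hasSum_integral_of_dominated_convergence (μ := MeasureTheory.volume)
    (a := 0) (b := π/2)
    (F := fun (p : ℕ × ℕ) (θ : ℝ) => (cc p.1 * t ^ p.1) * (cc p.2 * t ^ p.2) *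
      Real.cos (2 * ((p.1 : ℝ) - p.2) * θ))
    (f := fun θ => √(1 + t^2 + 2 * t * Real.cos (2 * θ)))
    (fun p _ => (|cc p.1| * t ^ p.1) * (|cc p.2| * t ^ p.2))
    (fun p => (by fun_prop : Continuous _).aestronglyMeasurable)
    (fun p => Eventually.of_forall fun θ _ => by
      rw [norm_mul, norm_mul, norm_mul, norm_mul]
      simp only [Real.norm_eq_abs, abs_pow, abs_of_nonneg h0]
      exact mul_le_of_le_one_right (by positivity) (Real.abs_cos_le_one _))
    (Eventually.of_forall fun θ _ => hb)
    (by simp)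
    (Eventually.of_forall fun θ _ => dbl t h0 h1 θ)
  have hinj : Function.Injective (fun n : ℕ => (n, n)) := fun a b hab => by simpa using hab
  rw [← hinj.hasSum_iff] at h
  · have h2 := h.mul_left (2 / π)
    have e : (fun n => cc n ^ 2 * (t ^ 2) ^ n) = fun n : ℕ => 2 / π *
        ∫ θ in (0:ℝ)..(π/2), (cc n * t ^ n) * (cc n * t ^ n) *
          Real.cos (2 * ((n : ℝ) - n) * θ) := by
      ext n
      simp only [sub_self, mul_zero, zero_mul, Real.cos_zero, mul_one,
        intervalIntegral.integral_const, sub_zero, smul_eq_mul]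
      field_simp
      ring
    rw [e]
    exact h2
  · rintro ⟨n, m⟩ hnm
    have : n ≠ m := by
      rintro rfl
      exact hnm ⟨n, rfl⟩
    rw [intervalIntegral.integral_const_mul, cos_int n m this, mul_zero]

lemma II_cont : Continuous II := by
  unfold II
  apply intervalIntegral.continuous_parametric_intervalIntegral_of_continuous'
  simp only [Function.uncurry_def]
  fun_prop

lemma II_one : II 1 = 2 := by
  have : ∀ θ ∈ Set.uIcc (0:ℝ) (π/2), √(1 + 1^2 + 2 * 1 * Real.cos (2 * θ)) = 2 * Real.cos θ := by
    intro θ hθ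
    rw [Set.uIcc_of_le (by positivity)] at hθ
    have hc : 0 ≤ Real.cos θ := Real.cos_nonneg_of_mem_Icc ⟨by linarith [hθ.1, Real.pi_pos], hθ.2⟩
    rw [Real.cos_two_mul, show 1 + 1^2 + 2 * 1 * (2 * Real.cos θ ^ 2 - 1) = (2 * Real.cos θ)^2 by ring,
      Real.sqrt_sq (by positivity)]
  rw [II, intervalIntegral.integral_congr this]
  simp

lemma mono (t s : ℝ) (h0 : 0 ≤ t) (hts : t ≤ s) (h1 : s < 1) :
    (2 / π * II t - 1) * s^2 ≤ (2 / π * II s - 1) * t^2 := by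
  have ht := (hasSum_nat_add_iff' 1).mpr (II_hasSum t h0 (hts.trans_lt h1))
  have hs := (hasSum_nat_add_iff' 1).mpr (II_hasSum s (h0.trans hts) h1)
  simp only [Finset.sum_range_one, cc0, pow_zero, one_pow, mul_one] at ht hs
  refine hasSum_le (fun n => ?_) (ht.mul_right (s^2)) (hs.mul_right (t^2))
  have : (t^2)^n ≤ (s^2)^n := by gcongr
  have h3 : 0 ≤ cc (n+1) ^ 2 * (t^2 * s^2) := by positivity
  calc _ = cc (n+1) ^ 2 * (t^2 * s^2) * (t^2)^n := by ring
    _ ≤ cc (n+1) ^ 2 * (t^2 * s^2) * (s^2)^n := by gcongr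
    _ = _ := by ring

lemma upperG (t : ℝ) (h0 : 0 ≤ t) (h1 : t < 1) :
    2 / π * II t - 1 ≤ (4 / π - 1) * t^2 := by
  have l1 : Tendsto (fun s : ℝ => (2 / π * II t - 1) * s^2) (𝓝[<] 1)
      (𝓝 ((2 / π * II t - 1) * 1^2)) := by
    apply Tendsto.mono_left _ nhdsWithin_le_nhds
    exact Continuous.tendsto (by fun_prop) 1
  have l2 : Tendsto (fun s : ℝ => (2 / π * II s - 1) * t^2) (𝓝[<] 1)
      (𝓝 ((2 / π * II 1 - 1) * t^2)) := by
    apply Tendsto.mono_left _ nhdsWithin_le_nhds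
    have := II_cont
    exact Continuous.tendsto (by fun_prop) 1
  have := le_of_tendsto_of_tendsto l1 l2 (by
    filter_upwards [Ioo_mem_nhdsLT h1] with s hs
    exact mono t s h0 hs.1.le hs.2)
  rw [II_one] at this
  linarith [show (4 / π - 1) * t^2 = (2 / π * 2 - 1) * t^2 by ring]

lemma lowerG (t : ℝ) (h0 : 0 < t) (h1 : t < 1) :
    (1 + t^2/8)^2 < 2 / π * II t := by
  have h := sum_le_hasSum (Finset.range 4) (fun n _ => by positivity) (II_hasSum t h0.le h1)
  simp only [Finset.sum_range_succ, Finset.sum_range_zero, cc0, cc1, cc2, cc3] at h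
  have : 0 < t^6 := by positivity
  nlinarith

lemma E_eq (r : ℝ) (hr : r ∈ Ioo (0:ℝ) 1) :
    ellipticE r = (1 + √(1 - r^2)) / 2 * II ((1 - √(1 - r^2)) / (1 + √(1 - r^2))) := by
  rw [ellipticE, II, ← intervalIntegral.integral_const_mul]
  congr 1
  ext θ
  have hb2 : √(1 - r^2) ^ 2 = 1 - r^2 := Real.sq_sqrt (by nlinarith [hr.1, hr.2])
  set b := √(1 - r^2)
  have hb : 0 ≤ b := Real.sqrt_nonneg _
  have hp : 0 < 1 + b := by linarith
  have hr2 : r^2 = 1 - b^2 := by linarith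
  rw [← Real.sqrt_sq (by positivity : 0 ≤ (1 + b) / 2), ← Real.sqrt_mul (by positivity)]
  congr 1
  rw [Real.cos_two_mul, Real.cos_sq', hr2]
  field_simp
  ring

/-- Corollary 3.1: with λ = 1/2 + √2/8 and μ = 1/2 + √((4/π)² − 1)/2,
π(1+r')⁻³([λ+(1−λ)r']² + [(1−λ)+λr']²)² < E(r)
  < (π/2)(([μ+(1−μ)r']² + [(1−μ)+μr']²)/2)^{1/2} for all r ∈ (0,1). -/
theorem stmt_17 (lam mu : ℝ) (hlam : lam = 1/2 + Real.sqrt 2 / 8)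
    (hmu : mu = 1/2 + Real.sqrt ((4/π)^2 - 1) / 2) (r : ℝ) (hr : r ∈ Ioo (0:ℝ) 1) :
    π / (1 + Real.sqrt (1 - r^2))^3 *
      ((lam + (1 - lam) * Real.sqrt (1 - r^2))^2
        + ((1 - lam) + lam * Real.sqrt (1 - r^2))^2)^2 < ellipticE r ∧
    ellipticE r <
      π/2 * Real.sqrt (((mu + (1 - mu) * Real.sqrt (1 - r^2))^2
        + ((1 - mu) + mu * Real.sqrt (1 - r^2))^2) / 2) := by
  rw [E_eq r hr]
  have hb2 : √(1 - r^2) ^ 2 = 1 - r^2 := Real.sq_sqrt (by nlinarith [hr.1, hr.2])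
  have hb0 : 0 < √(1 - r^2) := Real.sqrt_pos.mpr (by nlinarith [hr.1, hr.2])
  set b := √(1 - r^2)
  have hr0 : 0 < r ^ 2 := pow_pos hr.1 2
  have hb1 : b < 1 := by nlinarith
  have hp : 0 < 1 + b := by linarith
  have hpi := Real.pi_pos
  obtain ⟨t, ht⟩ : ∃ t, t = (1 - b) / (1 + b) := ⟨_, rfl⟩
  rw [← ht]
  have ht0 : 0 < t := by rw [ht]; exact div_pos (by linarith) hp
  have ht1 : t < 1 := by rw [ht, div_lt_one hp]; linarith
  have htb : 1 - b = t * (1 + b) := by rw [ht]; field_simp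
  have key : ∀ m : ℝ, (m + (1 - m) * b)^2 + ((1 - m) + m * b)^2
      = (1 + b)^2 / 2 * (1 + (2 * m - 1)^2 * t^2) := by
    intro m
    have : (1 + b)^2 / 2 * (1 + (2 * m - 1)^2 * t^2)
      = (1 + b)^2 / 2 + (2 * m - 1)^2 / 2 * (t * (1 + b))^2 := by ring
    rw [this, ← htb]; ring
  rw [key, key]
  have hI : II t = π / 2 * (2 / π * II t) := by field_simp
  have hlo := lowerG t ht0 ht1
  have hup := upperG t ht0.le ht1
  rw [hI]
  set G := 2 / π * II t
  constructor
  · have h2 : (2 * lam - 1)^2 = 1/8 := by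
      rw [hlam]; ring_nf; rw [Real.sq_sqrt (by norm_num)]; norm_num
    rw [h2]
    calc _ = (1 + b) / 2 * (π / 2 * (1 + t^2/8)^2) := by field_simp
      _ < _ := by gcongr
  · have hk : 0 < 4 / π - 1 := by
      rw [sub_pos, lt_div_iff₀ hpi]; linarith [Real.pi_lt_four]
    set k := 4 / π - 1 with hkdef
    have h4 : 4 / π = 1 + k := by rw [hkdef]; ring
    have h2 : (2 * mu - 1)^2 = 2 * k + k^2 := by
      rw [hmu, h4]; ring_nf; rw [Real.sq_sqrt (by positivity)]
    rw [h2]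
    have hx0 : 0 < t^2 := by positivity
    have hx1 : t^2 < 1 := by nlinarith
    have hG1 : 1 < G := by nlinarith
    have hG : G < √(1 + (2 * k + k^2) * t^2) := by
      apply Real.lt_sqrt_of_sq_lt
      have : G ≤ 1 + k * t^2 := by linarith
      have h5 : G^2 ≤ (1 + k * t^2)^2 := by gcongr
      have h6 : 0 < k^2 * (t^2 * (1 - t^2)) := by
        have : 0 < 1 - t^2 := by linarith
        positivity
      nlinarith
    have h7 : √((1 + b)^2 / 2 * (1 + (2 * k + k^2) * t^2) / 2)
        = (1 + b) / 2 * √(1 + (2 * k + k^2) * t^2) := by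
      rw [show (1 + b)^2 / 2 * (1 + (2 * k + k^2) * t^2) / 2
        = ((1 + b) / 2)^2 * (1 + (2 * k + k^2) * t^2) by ring, Real.sqrt_mul (by positivity),
        Real.sqrt_sq (by positivity)]
    rw [h7]
    calc (1 + b) / 2 * (π / 2 * G) < (1 + b) / 2 * (π / 2 * √(1 + (2 * k + k^2) * t^2)) := by gcongr
      _ = _ := by ring
end

section
/- Let λ = 1/2 + √2/8. Then for all r ∈ (0,1), the inequality π(1+r')^{−3}([λ + (1−λ)r']² + [(1−λ) + λ r']²)² > (π/2)·((1 + r'^{3/2})/2)^{2/3} holds, i.e., the lower bound in Corollary 3.1 is strictly better than Vuorinen's lower bound (π/2)((1 + r'^{3/2})/2)^{2/3} for E(r). -/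
open Real Set

lemma poly_aux (s : ℝ) (h0 : 0 < s) (h1 : s < 1) :
    524288 * (1 + s^3)^2 * (1 + s^2)^9 < (9*s^4 + 14*s^2 + 9)^6 := by
  have e : (9*s^4 + 14*s^2 + 9)^6 - 524288 * (1 + s^3)^2 * (1 + s^2)^9
      = (1-s)^4 * (7153 + 28612*s + 313054*s^2 + 60580*s^3
        + s^4*(1797485 + 277424*(1-s)) + s^6*(5223544 + 1390192*(1-s))
        + s^8*(9981866 + 2615880*(1-s)) + s^10*(12891180 + 2615880*(1-s))
        + s^12*(11207554 + 1390192*(1-s)) + s^14*(6336312 + 277424*(1-s))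
        + 2074909*s^16 + 60580*s^17 + 313054*s^18 + 28612*s^19 + 7153*s^20) := by
    ring
  have h2 : 0 < 1 - s := by linarith
  have : 0 < (9*s^4 + 14*s^2 + 9)^6 - 524288 * (1 + s^3)^2 * (1 + s^2)^9 := by
    rw [e]
    generalize 1 - s = u at h2
    positivity
  linarith

/-- Remark 4.5: with λ = 1/2 + √2/8 and r' = √(1 − r²), for all r ∈ (0,1) the lower bound
π(1+r')⁻³([λ+(1−λ)r']² + [(1−λ)+λr']²)² of Corollary 3.1 is strictly greater than
Vuorinen's bound (π/2)((1+r'^{3/2})/2)^{2/3}. -/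
theorem stmt_19 (lam : ℝ) (hlam : lam = 1/2 + Real.sqrt 2 / 8) (r : ℝ)
    (hr : r ∈ Ioo (0:ℝ) 1) :
    π/2 * ((1 + Real.sqrt (1 - r^2) ^ ((3:ℝ)/2)) / 2) ^ ((2:ℝ)/3) <
      π / (1 + Real.sqrt (1 - r^2))^3 *
        ((lam + (1 - lam) * Real.sqrt (1 - r^2))^2
          + ((1 - lam) + lam * Real.sqrt (1 - r^2))^2)^2 := by
  obtain ⟨hr0, hr1⟩ := hr
  have ht0 : 0 < Real.sqrt (1 - r^2) := Real.sqrt_pos.mpr (by nlinarith)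
  have ht1 : Real.sqrt (1 - r^2) < 1 := by
    rw [Real.sqrt_lt' one_pos]; nlinarith
  generalize Real.sqrt (1 - r^2) = t at ht0 ht1
  obtain ⟨s, hs0, rfl⟩ : ∃ s : ℝ, 0 < s ∧ s^2 = t :=
    ⟨Real.sqrt t, Real.sqrt_pos.mpr ht0, Real.sq_sqrt ht0.le⟩
  have hs1 : s < 1 := by nlinarith
  have h2 : Real.sqrt 2 ^ 2 = 2 := Real.sq_sqrt (by norm_num)
  have hsum : (lam + (1 - lam) * s^2)^2 + ((1 - lam) + lam * s^2)^2
      = (9*s^4 + 14*s^2 + 9)/16 := by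
    have hl : lam^2 = lam - 7/32 := by
      rw [hlam]; linear_combination h2/64
    linear_combination (2 - 4*s^2 + 2*s^4) * hl
  have hp : (s^2) ^ ((3:ℝ)/2) = s^3 := by
    rw [← Real.rpow_natCast s 2, ← Real.rpow_mul hs0.le, ← Real.rpow_natCast s 3]
    norm_num
  rw [hsum, hp]
  have key : ((1 + s^3)/2) ^ ((2:ℝ)/3) < (9*s^4 + 14*s^2 + 9)^2 / (128 * (1+s^2)^3) := by
    have hA : 0 ≤ (1 + s^3)/2 := by positivity
    refine lt_of_pow_lt_pow_left₀ 3 (by positivity) ?_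
    have : (((1 + s^3)/2) ^ ((2:ℝ)/3))^3 = ((1 + s^3)/2)^2 := by
      rw [← Real.rpow_natCast _ 3, ← Real.rpow_mul hA, ← Real.rpow_natCast _ 2]
      norm_num
    rw [this, div_pow _ (128 * (1+s^2)^3), lt_div_iff₀ (by positivity)]
    have := poly_aux s hs0 hs1
    calc _ = 524288 * (1 + s^3)^2 * (1 + s^2)^9 := by ring
      _ < _ := this
      _ = _ := by ring
  calc _ < π/2 * ((9*s^4 + 14*s^2 + 9)^2 / (128 * (1+s^2)^3)) :=
        mul_lt_mul_of_pos_left key (by positivity)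
    _ = _ := by field_simp; norm_num
end
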